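/- arXiv:2603.19110 — 4 statements merged into one kernel-verified Lean document; each statement's English description precedes it below -/
import Mathlib

section
/- For every real constant c > 1 there exist a constant d > 0 and N ∈ ℕ such that for all n ≥ N, every integer m ≥ c·n, and every fixed matrix B ∈ F₂^{m×2n}: if A is a uniformly random full-rank isotropic matrix in F₂^{2n×n}, then the base-2 Shannon entropy of the random matrix B·A ∈ F₂^{m×n} is at most (1 − d)·m·n. -/
open scoped BigOperators Classical

/-- The symplectic inner product on `F₂^{2n}` (coordinates indexed by `Fin n ⊕ Fin n`). -/
def symp {n : ℕ} (u v : (Fin n ⊕ Fin n) → ZMod 2) : ZMod 2 :=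
  ∑ i : Fin n, (u (Sum.inl i) * v (Sum.inr i) + u (Sum.inr i) * v (Sum.inl i))

/-- A matrix with `2n` rows is isotropic if its columns are pairwise symplectically
orthogonal. -/
def IsIsotropic {n k : ℕ} (A : Matrix (Fin n ⊕ Fin n) (Fin k) (ZMod 2)) : Prop :=
  ∀ i j : Fin k, symp (fun r => A r i) (fun r => A r j) = 0

/-- The set of full-rank isotropic matrices in `F₂^{2n×k}`. -/
noncomputable def fullRankIso (n k : ℕ) :
    Finset (Matrix (Fin n ⊕ Fin n) (Fin k) (ZMod 2)) :=
  Finset.univ.filter fun A => A.rank = k ∧ IsIsotropic A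

/-- The probability mass function of `B·A`, for `A` uniformly random on the full-rank
isotropic matrices in `F₂^{2n×n}`. -/
noncomputable def imgProb (n m : ℕ) (B : Matrix (Fin m) (Fin n ⊕ Fin n) (ZMod 2))
    (M : Matrix (Fin m) (Fin n) (ZMod 2)) : ℝ :=
  (((fullRankIso n n).filter fun A => B * A = M).card : ℝ) / ((fullRankIso n n).card : ℝ)

/-- The symplectic form as a bilinear form. -/
noncomputable def sympForm (n : ℕ) : LinearMap.BilinForm (ZMod 2) ((Fin n ⊕ Fin n) → ZMod 2) :=
  LinearMap.mk₂ (ZMod 2) (fun u v => symp u v)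
    (by intro a b c
        simp only [symp, Pi.add_apply, ← Finset.sum_add_distrib]
        exact Finset.sum_congr rfl fun i _ => by ring)
    (by intro a b c
        simp only [symp, Pi.smul_apply, smul_eq_mul, Finset.mul_sum]
        exact Finset.sum_congr rfl fun i _ => by ring)
    (by intro a b c
        simp only [symp, Pi.add_apply, ← Finset.sum_add_distrib]
        exact Finset.sum_congr rfl fun i _ => by ring)
    (by intro a b c
        simp only [symp, Pi.smul_apply, smul_eq_mul, Finset.mul_sum]
        exact Finset.sum_congr rfl fun i _ => by ring)

lemma sympForm_apply {n : ℕ} (u v : (Fin n ⊕ Fin n) → ZMod 2) : sympForm n u v = symp u v := rfl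

lemma symp_comm' {n : ℕ} (u v : (Fin n ⊕ Fin n) → ZMod 2) : symp u v = symp v u := by
  simp only [symp]
  exact Finset.sum_congr rfl fun i _ => by ring

/-- Dot product with `w` is the symplectic product with the swapped vector. -/
lemma symp_swap {n : ℕ} (w v : (Fin n ⊕ Fin n) → ZMod 2) :
    symp (fun r => w r.swap) v = ∑ r, w r * v r := by
  simp only [symp, Fintype.sum_sum_type, Sum.swap_inl, Sum.swap_inr, Finset.sum_add_distrib]
  rw [add_comm]

lemma symp_swap_swap {n : ℕ} (w v : (Fin n ⊕ Fin n) → ZMod 2) :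
    symp (fun r => w r.swap) (fun r => v r.swap) = symp w v := by
  simp only [symp, Sum.swap_inl, Sum.swap_inr]
  exact Finset.sum_congr rfl fun i _ => by ring

lemma sympForm_nondeg (n : ℕ) : (sympForm n).Nondegenerate := by
  have key : ∀ u : (Fin n ⊕ Fin n) → ZMod 2, (∀ v, symp u v = 0) → u = 0 := by
    intro u hu
    funext r
    have h := hu (Pi.single r.swap 1)
    have h2 := symp_swap (fun r => u r.swap) (Pi.single r.swap (1 : ZMod 2))
    simp only [Sum.swap_swap] at h2
    rw [h] at h2
    simpa [Pi.single_apply] using h2.symm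
  refine ⟨fun u hu => key u hu, fun u hu => key u fun v => ?_⟩
  rw [symp_comm']
  exact hu v

lemma finrank_V (n : ℕ) : Module.finrank (ZMod 2) ((Fin n ⊕ Fin n) → ZMod 2) = 2 * n := by
  simp [two_mul]

lemma ker_isotropic {n : ℕ} (A : Matrix (Fin n ⊕ Fin n) (Fin n) (ZMod 2)) (hr : A.rank = n)
    (hA : IsIsotropic A) (w w' : (Fin n ⊕ Fin n) → ZMod 2)
    (hw : Matrix.vecMul w A = 0) (hw' : Matrix.vecMul w' A = 0) : symp w w' = 0 := by
  set L : Submodule (ZMod 2) ((Fin n ⊕ Fin n) → ZMod 2) :=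
    Submodule.span (ZMod 2) (Set.range A.col) with hL
  have hLr : Module.finrank (ZMod 2) L = n := by
    rw [hL, ← Matrix.rank_eq_finrank_span_cols, hr]
  have hLiso : L ≤ (sympForm n).orthogonal L := by
    rw [hL, Submodule.span_le]
    rintro _ ⟨j, rfl⟩
    rw [SetLike.mem_coe, LinearMap.BilinForm.mem_orthogonal_iff]
    intro x hx
    change symp x (A.col j) = 0
    have : Submodule.span (ZMod 2) (Set.range A.col) ≤ LinearMap.ker (sympForm n (A.col j)) := by
      rw [Submodule.span_le]
      rintro _ ⟨i, rfl⟩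
      exact hA j i
    rw [symp_comm']
    exact this hx
  have hLeq : L = (sympForm n).orthogonal L := by
    apply Submodule.eq_of_le_of_finrank_eq hLiso
    rw [LinearMap.BilinForm.finrank_orthogonal (sympForm_nondeg n), hLr, finrank_V]
    omega
  have hmem : ∀ w : (Fin n ⊕ Fin n) → ZMod 2, Matrix.vecMul w A = 0 →
      (fun r : Fin n ⊕ Fin n => w r.swap) ∈ L := by
    intro w hw
    rw [hLeq, LinearMap.BilinForm.mem_orthogonal_iff]
    intro x hx
    change symp x (fun r : Fin n ⊕ Fin n => w r.swap) = 0
    rw [symp_comm']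
    have : Submodule.span (ZMod 2) (Set.range A.col) ≤
        LinearMap.ker (sympForm n (fun r : Fin n ⊕ Fin n => w r.swap)) := by
      rw [Submodule.span_le]
      rintro _ ⟨i, rfl⟩
      change symp (fun r : Fin n ⊕ Fin n => w r.swap) (A.col i) = 0
      rw [symp_swap]
      exact congrFun hw i
    exact this hx
  rw [← symp_swap_swap]
  exact hLiso (hmem w' hw') _ (hmem w hw)

/-- Vectors of `R` orthogonal to all the `u i`. -/
noncomputable def orthTo {n t : ℕ} (R : Submodule (ZMod 2) ((Fin n ⊕ Fin n) → ZMod 2))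
    (u : Fin t → R) : Submodule (ZMod 2) ((Fin n ⊕ Fin n) → ZMod 2) :=
  R ⊓ ⨅ i, LinearMap.ker (sympForm n (u i))

lemma orthTo_cons {n t : ℕ} (R : Submodule (ZMod 2) ((Fin n ⊕ Fin n) → ZMod 2))
    (x : R) (u : Fin t → R) :
    orthTo R (Fin.cons x u : Fin (t + 1) → R) = orthTo R u ⊓ LinearMap.ker (sympForm n x) := by
  ext w
  simp only [orthTo, Submodule.mem_inf, Submodule.mem_iInf, Fin.forall_fin_succ, Fin.cons_zero,
    Fin.cons_succ]
  tauto

lemma natCard_sub {W : Type*} [AddCommGroup W] [Module (ZMod 2) W] [Finite W] :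
    Nat.card W = 2 ^ Module.finrank (ZMod 2) W := by
  rw [Module.natCard_eq_pow_finrank (K := ZMod 2)]
  simp

lemma card_filter_le_orth {n : ℕ} (R K : Submodule (ZMod 2) ((Fin n ⊕ Fin n) → ZMod 2)) :
    (Finset.univ.filter fun x : R => K ≤ LinearMap.ker (sympForm n x)).card * Nat.card K
      ≤ 2 ^ (2 * n) := by
  have h1 : (Finset.univ.filter fun x : R => K ≤ LinearMap.ker (sympForm n x)).card ≤
      Nat.card ((sympForm n).orthogonal K) := by
    rw [Nat.card_eq_fintype_card, ← Finset.card_univ]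
    have : ∀ x ∈ (Finset.univ.filter fun x : R => K ≤ LinearMap.ker (sympForm n x)),
        (x : (Fin n ⊕ Fin n) → ZMod 2) ∈ (sympForm n).orthogonal K := by
      intro x hx w hw
      have := (Finset.mem_filter.1 hx).2 hw
      change symp _ _ = 0
      rw [symp_comm']
      exact this
    refine Finset.card_le_card_of_injOn
      (fun x => if h : (x : (Fin n ⊕ Fin n) → ZMod 2) ∈ (sympForm n).orthogonal K
        then ⟨x, h⟩ else 0) (fun _ _ => Finset.mem_coe.2 (Finset.mem_univ _)) ?_
    intro x hx y hy hxy
    simp only [this x hx, this y hy, dif_pos] at hxy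
    exact Subtype.ext (Subtype.mk.inj hxy)
  have hK := Submodule.finrank_le K
  rw [finrank_V] at hK
  calc _ ≤ Nat.card ((sympForm n).orthogonal K) * Nat.card K := Nat.mul_le_mul_right _ h1
    _ = 2 ^ (2 * n) := by
      rw [natCard_sub, natCard_sub, LinearMap.BilinForm.finrank_orthogonal (sympForm_nondeg n),
        finrank_V, ← pow_add]
      congr 1
      omega

lemma card_inf_ker {n : ℕ} (K : Submodule (ZMod 2) ((Fin n ⊕ Fin n) → ZMod 2))
    (x : (Fin n ⊕ Fin n) → ZMod 2) (h : ¬ K ≤ LinearMap.ker (sympForm n x)) :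
    2 * Nat.card (K ⊓ LinearMap.ker (sympForm n x) : Submodule _ _) ≤ Nat.card K := by
  have hlt : K ⊓ LinearMap.ker (sympForm n x) < K := by
    refine lt_of_le_of_ne inf_le_left fun h' => h (inf_eq_left.1 h')
  have := Submodule.finrank_lt_finrank_of_lt hlt
  rw [natCard_sub, natCard_sub, ← pow_succ']
  exact Nat.pow_le_pow_right (by norm_num) this

/-- Number of pairs of tuples that are mutually orthogonal. -/
noncomputable def TT {n : ℕ} (R : Submodule (ZMod 2) ((Fin n ⊕ Fin n) → ZMod 2)) (t c : ℕ) : ℕ :=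
  ∑ u : Fin t → R, Nat.card (orthTo R u) ^ c

lemma TT_succ {n : ℕ} (R : Submodule (ZMod 2) ((Fin n ⊕ Fin n) → ZMod 2)) (t c : ℕ) :
    2 ^ (c + 1) * TT R (t + 1) (c + 1) ≤
      2 ^ (c + 1) * 2 ^ (2 * n) * TT R t c +
        2 ^ Module.finrank (ZMod 2) R * TT R t (c + 1) := by
  have h0 : TT R (t + 1) (c + 1) = ∑ u : Fin t → R, ∑ x : R,
      Nat.card (orthTo R u ⊓ LinearMap.ker (sympForm n x) : Submodule _ _) ^ (c + 1) := by
    unfold TT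
    rw [← (Fin.consEquiv (fun _ : Fin (t + 1) => (R : Type))).sum_comp, Fintype.sum_prod_type,
      Finset.sum_comm]
    refine Finset.sum_congr rfl fun u _ => Finset.sum_congr rfl fun x _ => ?_
    rw [← orthTo_cons]
    rfl
  rw [h0, TT, TT, Finset.mul_sum, Finset.mul_sum, Finset.mul_sum, ← Finset.sum_add_distrib]
  refine Finset.sum_le_sum fun u _ => ?_
  set K := orthTo R u
  rw [← Finset.sum_filter_add_sum_filter_not Finset.univ
    (fun x : R => K ≤ LinearMap.ker (sympForm n x)), mul_add]
  refine add_le_add ?_ ?_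
  · have : ∀ x ∈ (Finset.univ.filter fun x : R => K ≤ LinearMap.ker (sympForm n x)),
      Nat.card (K ⊓ LinearMap.ker (sympForm n x) : Submodule _ _) ^ (c + 1) =
        Nat.card K ^ (c + 1) := by
      intro x hx
      rw [inf_eq_left.2 (Finset.mem_filter.1 hx).2]
    rw [Finset.sum_congr rfl this, Finset.sum_const, smul_eq_mul, mul_assoc]
    refine Nat.mul_le_mul_left _ ?_
    rw [pow_succ', ← mul_assoc]
    exact Nat.mul_le_mul_right _ (card_filter_le_orth R K)
  · rw [Finset.mul_sum]
    calc _ ≤ ∑ x ∈ (Finset.univ.filter fun x : R => ¬ K ≤ LinearMap.ker (sympForm n x)),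
          Nat.card K ^ (c + 1) := by
          refine Finset.sum_le_sum fun x hx => ?_
          rw [← mul_pow]
          exact Nat.pow_le_pow_left (card_inf_ker K x (Finset.mem_filter.1 hx).2) _
      _ ≤ ∑ x : R, Nat.card K ^ (c + 1) :=
          Finset.sum_le_sum_of_subset (Finset.filter_subset _ _)
      _ = _ := by
          rw [Finset.sum_const, smul_eq_mul, Finset.card_univ, ← Nat.card_eq_fintype_card,
            natCard_sub]

lemma TT_bound {n : ℕ} (R : Submodule (ZMod 2) ((Fin n ⊕ Fin n) → ZMod 2)) (t : ℕ) :
    ∀ k : ℕ, 2 * n + k + t ≤ 2 * Module.finrank (ZMod 2) R →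
    TT R t (t + k) * 2 ^ (t * k) ≤ 2 ^ (t + Module.finrank (ZMod 2) R * (2 * t + k)) := by
  set r := Module.finrank (ZMod 2) R with hr
  induction t with
  | zero =>
    intro k _
    have : ∀ u : Fin 0 → R, orthTo R u = R := by
      intro u
      simp [orthTo]
    simp only [TT, this, natCard_sub, ← hr]
    simp [← pow_mul]
  | succ t ih =>
    intro k hk
    have h1 := ih k (by omega)
    have h2 := ih (k + 1) (by omega)
    have h3 := TT_succ R t (t + k)
    rw [← hr] at h3
    have e : t + 1 + k = t + k + 1 := by ring
    rw [e]
    refine Nat.le_of_mul_le_mul_left ?_ (Nat.two_pow_pos (t + k + 1))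
    have hA : 2 ^ (t + k + 1) * 2 ^ (2 * n) * TT R t (t + k) * 2 ^ ((t + 1) * k) ≤
        2 ^ (t + k + 1) * 2 ^ (t + r * (2 * (t + 1) + k)) := by
      calc _ = 2 ^ (t + k + 1) * (2 ^ (2 * n + k) * (TT R t (t + k) * 2 ^ (t * k))) := by ring
        _ ≤ 2 ^ (t + k + 1) * (2 ^ (2 * n + k) * 2 ^ (t + r * (2 * t + k))) := by gcongr
        _ = 2 ^ (t + k + 1) * 2 ^ (2 * n + k + (t + r * (2 * t + k))) := by rw [← pow_add]
        _ ≤ _ := by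
          refine Nat.mul_le_mul_left _ (Nat.pow_le_pow_right (by norm_num) ?_)
          have : r * (2 * (t + 1) + k) = 2 * r + r * (2 * t + k) := by ring
          omega
    have hB : 2 ^ r * TT R t (t + k + 1) * 2 ^ ((t + 1) * k) ≤
        2 ^ (t + k + 1) * 2 ^ (t + r * (2 * (t + 1) + k)) := by
      calc _ ≤ 2 ^ r * TT R t (t + k + 1) * 2 ^ (t * (k + 1) + k) := by
            gcongr
            · norm_num
            · nlinarith
        _ = 2 ^ (r + k) * (TT R t (t + (k + 1)) * 2 ^ (t * (k + 1))) := by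
            rw [add_assoc t k 1]; ring
        _ ≤ 2 ^ (r + k) * 2 ^ (t + r * (2 * t + (k + 1))) := by gcongr
        _ = 2 ^ (r + k + (t + r * (2 * t + (k + 1)))) := by rw [← pow_add]
        _ ≤ _ := by
          rw [← pow_add]
          refine Nat.pow_le_pow_right (by norm_num) ?_
          have : r * (2 * (t + 1) + k) = r + r * (2 * t + (k + 1)) := by ring
          omega
    calc _ = (2 ^ (t + k + 1) * TT R (t + 1) (t + k + 1)) * 2 ^ ((t + 1) * k) := by ring
      _ ≤ (2 ^ (t + k + 1) * 2 ^ (2 * n) * TT R t (t + k) + 2 ^ r * TT R t (t + k + 1))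
          * 2 ^ ((t + 1) * k) := Nat.mul_le_mul_right _ h3
      _ ≤ _ := by
          rw [add_mul]
          refine (add_le_add hA hB).trans (le_of_eq ?_)
          ring

/-- The pairs counted by `TT` bound the number of isotropic tuples. -/
lemma card_iso_le_TT {n : ℕ} (R : Submodule (ZMod 2) ((Fin n ⊕ Fin n) → ZMod 2)) (t c : ℕ)
    (T : Finset (Fin (t + c) → R))
    (hT : ∀ U ∈ T, ∀ i j, symp (U i : (Fin n ⊕ Fin n) → ZMod 2) (U j) = 0) :
    T.card ≤ TT R t c := by
  have h1 : TT R t c = Fintype.card (Σ u : Fin t → R, (Fin c → orthTo R u)) := by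
    rw [Fintype.card_sigma, TT]
    refine Finset.sum_congr rfl fun u _ => ?_
    rw [Fintype.card_fun, Fintype.card_fin, Nat.card_eq_fintype_card]
  rw [h1, ← Fintype.card_coe]
  have hmem : ∀ U ∈ T, ∀ j : Fin c, (U (Fin.natAdd t j) : (Fin n ⊕ Fin n) → ZMod 2) ∈
      orthTo R (fun i => U (Fin.castAdd c i)) := by
    intro U hU j
    simp only [orthTo, Submodule.mem_inf, Submodule.mem_iInf]
    exact ⟨(U _).2, fun i => hT U hU _ _⟩
  refine Fintype.card_le_of_injective
    (fun U : T => (⟨fun i => U.1 (Fin.castAdd c i), fun j => ⟨_, hmem U.1 U.2 j⟩⟩ :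
      Σ u : Fin t → R, (Fin c → orthTo R u))) ?_
  rintro ⟨U, hU⟩ ⟨U', hU'⟩ h
  have h2 : ∀ i, U (Fin.castAdd c i) = U' (Fin.castAdd c i) := by
    intro i
    exact congrFun (congrArg Sigma.fst h) i
  have h3 : ∀ j, U (Fin.natAdd t j) = U' (Fin.natAdd t j) := by
    intro j
    have := congrArg (fun s : (Σ u : Fin t → R, (Fin c → orthTo R u)) =>
      ((s.2 j : orthTo R s.1) : (Fin n ⊕ Fin n) → ZMod 2)) h
    exact Subtype.ext this
  apply Subtype.ext
  funext k
  exact Fin.addCases (motive := fun k => U k = U' k) h2 h3 k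

lemma finite_lin {R W : Type*} [AddCommGroup R] [AddCommGroup W] [Module (ZMod 2) R]
    [Module (ZMod 2) W] [Finite R] [Finite W] : Finite (R →ₗ[ZMod 2] W) :=
  DFunLike.finite _

lemma card_lin {n : ℕ} {R : Type*} [AddCommGroup R] [Module (ZMod 2) R] [Finite R] :
    Nat.card (R →ₗ[ZMod 2] (Fin n → ZMod 2)) = 2 ^ (Module.finrank (ZMod 2) R * n) := by
  have : Finite (R →ₗ[ZMod 2] (Fin n → ZMod 2)) := finite_lin
  rw [natCard_sub, Module.finrank_linearMap]
  simp

lemma card_vanish {n k : ℕ} {R : Type*} [AddCommGroup R] [Module (ZMod 2) R] [Finite R]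
    (Φ : Finset (R →ₗ[ZMod 2] (Fin n → ZMod 2))) (U : Fin k → R)
    (hU : LinearIndependent (ZMod 2) U) (h : ∀ φ ∈ Φ, ∀ i, φ (U i) = 0) :
    Φ.card ≤ 2 ^ ((Module.finrank (ZMod 2) R - k) * n) := by
  set S := Submodule.span (ZMod 2) (Set.range U) with hS
  have hS1 : Module.finrank (ZMod 2) (R ⧸ S) = Module.finrank (ZMod 2) R - k := by
    rw [Submodule.finrank_quotient, hS, finrank_span_eq_card hU, Fintype.card_fin]
  have hle : ∀ φ ∈ Φ, S ≤ LinearMap.ker φ := by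
    intro φ hφ
    rw [hS, Submodule.span_le]
    rintro _ ⟨i, rfl⟩
    exact h φ hφ i
  have hfq : Finite (R ⧸ S) := Finite.of_surjective _ S.mkQ_surjective
  have : Finite ((R ⧸ S) →ₗ[ZMod 2] (Fin n → ZMod 2)) := finite_lin
  rw [← hS1, ← card_lin, ← Fintype.card_coe, ← Nat.card_eq_fintype_card]
  refine Nat.card_le_card_of_injective (fun φ : Φ => S.liftQ φ.1 (hle φ.1 φ.2)) ?_
  rintro ⟨φ, hφ⟩ ⟨ψ, hψ⟩ he
  apply Subtype.ext
  ext1 x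
  have := LinearMap.congr_fun he (S.mkQ x)
  simpa using this

lemma card_LI_ge {W : Type*} [AddCommGroup W] [Module (ZMod 2) W] [Finite W] (e k : ℕ)
    (hk : k ≤ e + 1) (he : e + 1 ≤ Module.finrank (ZMod 2) W) :
    2 ^ (e * k) ≤ Nat.card {s : Fin k → W // LinearIndependent (ZMod 2) s} := by
  rw [card_linearIndependent (hk.trans he)]
  simp only [ZMod.card]
  rw [pow_mul]
  calc (2 ^ e) ^ k = ∏ i : Fin k, 2 ^ e := by simp
    _ ≤ _ := by
      refine Finset.prod_le_prod' fun i _ => ?_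
      have h1 : 2 ^ (e + 1) ≤ 2 ^ Module.finrank (ZMod 2) W :=
        Nat.pow_le_pow_right (by norm_num) he
      have h2 : 2 ^ (i : ℕ) ≤ 2 ^ e := Nat.pow_le_pow_right (by norm_num) (by omega)
      rw [pow_succ] at h1
      omega

lemma count_main {n h e : ℕ} (R : Submodule (ZMod 2) ((Fin n ⊕ Fin n) → ZMod 2))
    (hr : Module.finrank (ZMod 2) R = n + (e + 1)) (he : h + (h + h) ≤ e + 1)
    (Φ : Finset (R →ₗ[ZMod 2] (Fin n → ZMod 2)))
    (hΦ : ∀ φ ∈ Φ, ∀ x y : R, φ x = 0 → φ y = 0 →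
      symp (x : (Fin n ⊕ Fin n) → ZMod 2) y = 0) :
    Φ.card * 2 ^ (h * h) ≤ 2 ^ (Module.finrank (ZMod 2) R * n + 4 * h) := by
  set r := Module.finrank (ZMod 2) R with hrdef
  set T : Finset (Fin (h + (h + h)) → R) := Finset.univ.filter fun U =>
    LinearIndependent (ZMod 2) U ∧ ∀ i j, symp (U i : (Fin n ⊕ Fin n) → ZMod 2) (U j) = 0 with hT
  have hdc := Finset.card_mul_le_card_mul (s := Φ) (t := T)
    (r := fun φ U => ∀ i, φ (U i) = 0) (m := 2 ^ (e * (h + (h + h))))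
    (n := 2 ^ ((r - (h + (h + h))) * n)) ?_ ?_
  · have h1 : T.card ≤ TT R h (h + h) :=
      card_iso_le_TT R h (h + h) T fun U hU => (Finset.mem_filter.1 hU).2.2
    have h2 := TT_bound R h h (by omega)
    rw [← hrdef] at h2
    have hpos : 0 < 2 ^ (e * (h + (h + h))) := Nat.two_pow_pos _
    refine Nat.le_of_mul_le_mul_right ?_ hpos
    calc _ = (Φ.card * 2 ^ (e * (h + (h + h)))) * 2 ^ (h * h) := by ring
      _ ≤ (T.card * 2 ^ ((r - (h + (h + h))) * n)) * 2 ^ (h * h) := Nat.mul_le_mul_right _ hdc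
      _ ≤ (TT R h (h + h) * 2 ^ ((r - (h + (h + h))) * n)) * 2 ^ (h * h) := by gcongr
      _ = (TT R h (h + h) * 2 ^ (h * h)) * 2 ^ ((r - (h + (h + h))) * n) := by ring
      _ ≤ 2 ^ (h + r * (2 * h + h)) * 2 ^ ((r - (h + (h + h))) * n) := by gcongr
      _ = 2 ^ (r * n + 4 * h) * 2 ^ (e * (h + (h + h))) := by
        rw [← pow_add, ← pow_add]
        congr 1
        obtain ⟨d, hd⟩ : ∃ d, r = d + (h + (h + h)) := ⟨r - (h + (h + h)), by omega⟩
        have : r - (h + (h + h)) = d := by omega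
        rw [this]
        have hr' : r * (2 * h + h) = (n + (e + 1)) * (2 * h + h) := by rw [hr]
        rw [hr', hd]
        ring
  · intro φ hφ
    set K := LinearMap.ker φ
    have hK : e + 1 ≤ Module.finrank (ZMod 2) K := by
      have h1 := LinearMap.finrank_range_add_finrank_ker φ
      have h2 := Submodule.finrank_le (LinearMap.range φ)
      simp only [Module.finrank_fin_fun] at h2
      change _ + Module.finrank (ZMod 2) K = r at h1
      omega
    refine (card_LI_ge (W := K) e _ he hK).trans ?_
    rw [← Fintype.card_coe, ← Nat.card_eq_fintype_card]
    refine Nat.card_le_card_of_injective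
      (fun s : {s : Fin (h + (h + h)) → K // LinearIndependent (ZMod 2) s} =>
        (⟨fun i => (s.1 i : R), ?_⟩ : {x // x ∈ Finset.bipartiteAbove
          (fun (φ : R →ₗ[ZMod 2] (Fin n → ZMod 2)) (U : Fin (h + (h + h)) → R) =>
            ∀ i, φ (U i) = 0) T φ})) ?_
    · rw [Finset.mem_bipartiteAbove]
      refine ⟨?_, fun i => (s.1 i).2⟩
      rw [hT, Finset.mem_filter]
      refine ⟨Finset.mem_univ _, ?_, fun i j => hΦ φ hφ _ _ (s.1 i).2 (s.1 j).2⟩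
      exact s.2.map' K.subtype (Submodule.ker_subtype K)
    · intro s s' hss
      apply Subtype.ext
      funext i
      apply Subtype.ext
      exact congrFun (Subtype.mk.inj hss) i
  · intro U hU
    refine card_vanish _ U (Finset.mem_filter.1 hU).2.1 ?_
    intro φ hφ
    exact (Finset.mem_bipartiteBelow _).1 hφ |>.2

lemma entropy_le {α : Type*} [Fintype α] (p : α → ℝ) (hp : ∀ a, 0 ≤ p a) (hs : ∑ a, p a = 1)
    (S : Finset α) (hS : ∀ a, a ∉ S → p a = 0) (x : ℝ) (hx : (S.card : ℝ) ≤ 2 ^ x) :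
    - ∑ a, p a * Real.logb 2 (p a) ≤ x := by
  have hl : 0 < Real.log 2 := Real.log_pos (by norm_num)
  have hN : (0 : ℝ) < 2 ^ x := by positivity
  have hsS : ∑ a ∈ S, p a = 1 := by
    rw [← hs]
    exact Finset.sum_subset (Finset.subset_univ _) fun a _ ha => hS a ha
  have h1 : ∑ a, p a * Real.logb 2 (p a) = ∑ a ∈ S, p a * Real.logb 2 (p a) := by
    symm
    refine Finset.sum_subset (Finset.subset_univ _) fun a _ ha => ?_
    rw [hS a ha, zero_mul]
  have key : ∀ a, -(p a * Real.logb 2 (p a)) ≤ p a * x + ((2 ^ x)⁻¹ - p a) / Real.log 2 := by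
    intro a
    rcases (hp a).eq_or_lt with h | h
    · rw [← h]
      simp only [zero_mul, neg_zero, zero_add, sub_zero]
      positivity
    · have hh : 0 < (p a * 2 ^ x)⁻¹ := by positivity
      have := Real.log_le_sub_one_of_pos hh
      rw [Real.log_inv, Real.log_mul h.ne' hN.ne', Real.log_rpow (by norm_num)] at this
      have h3 : p a * -(Real.log (p a) + x * Real.log 2) ≤ p a * ((p a * 2 ^ x)⁻¹ - 1) :=
        mul_le_mul_of_nonneg_left this h.le
      have h4 : p a * ((p a * 2 ^ x)⁻¹ - 1) = (2 ^ x)⁻¹ - p a := by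
        field_simp
      rw [h4] at h3
      rw [Real.logb]
      have h5 : -(p a * (Real.log (p a) / Real.log 2)) =
          p a * x + (p a * -(Real.log (p a) + x * Real.log 2)) / Real.log 2 := by
        field_simp
        ring
      rw [h5]
      gcongr
  rw [h1, ← Finset.sum_neg_distrib]
  calc _ ≤ ∑ a ∈ S, (p a * x + ((2 ^ x)⁻¹ - p a) / Real.log 2) :=
        Finset.sum_le_sum fun a _ => key a
    _ = x + (S.card * (2 ^ x)⁻¹ - 1) / Real.log 2 := by
        rw [Finset.sum_add_distrib, ← Finset.sum_mul, ← Finset.sum_div, Finset.sum_sub_distrib,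
          hsS, Finset.sum_const, nsmul_eq_mul, one_mul]
    _ ≤ x := by
        have : (S.card : ℝ) * (2 ^ x)⁻¹ ≤ 1 := by
          rw [← div_eq_mul_inv]
          exact (div_le_one hN).2 hx
        have : ((S.card : ℝ) * (2 ^ x)⁻¹ - 1) / Real.log 2 ≤ 0 :=
          div_nonpos_of_nonpos_of_nonneg (by linarith) hl.le
        linarith

/-- Linear map `R → F₂ⁿ` given by multiplication by `A` on the right. -/
noncomputable def restr {n : ℕ} (R : Submodule (ZMod 2) ((Fin n ⊕ Fin n) → ZMod 2))
    (A : Matrix (Fin n ⊕ Fin n) (Fin n) (ZMod 2)) : R →ₗ[ZMod 2] (Fin n → ZMod 2) :=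
  A.vecMulLinear ∘ₗ R.subtype

lemma restr_apply {n : ℕ} (R : Submodule (ZMod 2) ((Fin n ⊕ Fin n) → ZMod 2))
    (A : Matrix (Fin n ⊕ Fin n) (Fin n) (ZMod 2)) (x : R) :
    restr R A x = Matrix.vecMul (x : (Fin n ⊕ Fin n) → ZMod 2) A := rfl

lemma img_card_le {n m : ℕ} (B : Matrix (Fin m) (Fin n ⊕ Fin n) (ZMod 2))
    (R : Submodule (ZMod 2) ((Fin n ⊕ Fin n) → ZMod 2)) (hR : ∀ i, B i ∈ R) :
    ((fullRankIso n n).image fun A => B * A).card ≤ ((fullRankIso n n).image (restr R)).card := by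
  have : ((fullRankIso n n).image fun A => B * A) =
      ((fullRankIso n n).image (restr R)).image
        (fun φ => (Matrix.of fun i => φ ⟨B i, hR i⟩ : Matrix (Fin m) (Fin n) (ZMod 2))) := by
    rw [Finset.image_image]
    refine Finset.image_congr fun A _ => ?_
    ext i j
    rfl
  rw [this]
  exact Finset.card_image_le

lemma imgProb_entropy {n m : ℕ} (B : Matrix (Fin m) (Fin n ⊕ Fin n) (ZMod 2)) (x : ℝ)
    (hx0 : 0 ≤ x)
    (hx : (((fullRankIso n n).image fun A => B * A).card : ℝ) ≤ 2 ^ x) :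
    - ∑ M, imgProb n m B M * Real.logb 2 (imgProb n m B M) ≤ x := by
  by_cases h0 : (fullRankIso n n).card = 0
  · simp [imgProb, h0, hx0]
  · refine entropy_le _ (fun M => by unfold imgProb; positivity) ?_
      ((fullRankIso n n).image fun A => B * A) ?_ x hx
    · unfold imgProb
      rw [← Finset.sum_div, ← Nat.cast_sum, ← Finset.card_eq_sum_card_fiberwise
        (fun _ _ => Finset.mem_coe.2 (Finset.mem_univ _))]
      exact div_self (by exact_mod_cast h0)
    · intro M hM
      have : ((fullRankIso n n).filter fun A => B * A = M) = ∅ := by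
        rw [Finset.filter_eq_empty_iff]
        intro A hA hAM
        exact hM (Finset.mem_image.2 ⟨A, hA, hAM⟩)
      simp [imgProb, this]

lemma img_bounds {n m : ℕ} (B : Matrix (Fin m) (Fin n ⊕ Fin n) (ZMod 2)) :
    ∃ r : ℕ, r ≤ m ∧ r ≤ 2 * n ∧
      ((fullRankIso n n).image fun A => B * A).card ≤ 2 ^ (r * n) ∧
      ∀ h : ℕ, n + 1 + (h + (h + h)) ≤ r →
        ((fullRankIso n n).image fun A => B * A).card * 2 ^ (h * h) ≤ 2 ^ (r * n + 4 * h) := by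
  set R := Submodule.span (ZMod 2) (Set.range B.row) with hRdef
  have hR : ∀ i, B i ∈ R := fun i => Submodule.subset_span ⟨i, rfl⟩
  have : Finite (R →ₗ[ZMod 2] (Fin n → ZMod 2)) := finite_lin
  refine ⟨Module.finrank (ZMod 2) R, ?_, ?_, ?_, ?_⟩
  · have := finrank_range_le_card (R := ZMod 2) B.row
    simpa [Set.finrank] using this
  · exact (Submodule.finrank_le R).trans (finrank_V n).le
  · refine (img_card_le B R hR).trans ?_
    rw [← card_lin]
    rw [← Fintype.card_coe, ← Nat.card_eq_fintype_card]
    exact Nat.card_le_card_of_injective _ Subtype.val_injective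
  · intro h hh
    refine (Nat.mul_le_mul_right _ (img_card_le B R hR)).trans ?_
    refine count_main (e := Module.finrank (ZMod 2) R - n - 1) R (by omega) (by omega) _ ?_
    intro φ hφ x y hx hy
    obtain ⟨A, hA, rfl⟩ := Finset.mem_image.1 hφ
    have hA' := (Finset.mem_filter.1 hA).2
    exact ker_isotropic A hA'.1 hA'.2 x y hx hy

/-- For every `c > 1` there are `d > 0` and `N` such that for all `n ≥ N`, `m ≥ c·n`,
and every fixed `B ∈ F₂^{m×2n}`, the base-2 Shannon entropy of `B·A` (with `A` a
uniformly random full-rank isotropic matrix in `F₂^{2n×n}`) is at most `(1 - d)·m·n`. -/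
theorem stmt2 (c : ℝ) (hc : 1 < c) :
    ∃ d : ℝ, 0 < d ∧ ∃ N : ℕ, ∀ n : ℕ, N ≤ n → ∀ m : ℕ, c * n ≤ (m : ℝ) →
      ∀ B : Matrix (Fin m) (Fin n ⊕ Fin n) (ZMod 2),
        (- ∑ M : Matrix (Fin m) (Fin n) (ZMod 2),
            imgProb n m B M * Real.logb 2 (imgProb n m B M))
          ≤ (1 - d) * (m : ℝ) * (n : ℝ) := by
  obtain ⟨γ, hγ0, hγ1, hγc⟩ : ∃ γ : ℝ, 0 < γ ∧ γ ≤ 1 ∧ 1 + γ ≤ c :=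
    ⟨min (c - 1) 1, lt_min (by linarith) one_pos, min_le_right _ _,
      by linarith [min_le_left (c - 1) 1]⟩
  obtain ⟨N, hN⟩ := exists_nat_ge (128 / γ)
  have hd1 : γ ^ 2 / 2048 ≤ γ / 4 := by nlinarith
  refine ⟨γ ^ 2 / 2048, by positivity, N, ?_⟩
  intro n hn m hm B
  set d := γ ^ 2 / 2048 with hd
  have hd0 : 0 < d := by positivity
  have hγn : 128 ≤ γ * n := by
    have h1 : 128 / γ ≤ (n : ℝ) := hN.trans (by exact_mod_cast hn)
    rw [div_le_iff₀ hγ0] at h1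
    linarith
  have hn0 : (0 : ℝ) ≤ n := Nat.cast_nonneg n
  have hm0 : (0 : ℝ) ≤ m := Nat.cast_nonneg m
  have hmn : (1 + γ) * n ≤ m := (mul_le_mul_of_nonneg_right hγc hn0).trans hm
  have hd2 : 0 ≤ 1 - d := by linarith
  obtain ⟨r, hrm, hr2, hb1, hb2⟩ := img_bounds B
  have hrm' : (r : ℝ) ≤ m := by exact_mod_cast hrm
  have hr2' : (r : ℝ) ≤ 2 * n := by exact_mod_cast hr2
  apply imgProb_entropy B _ (by positivity)
  by_cases hcase : (r : ℝ) ≤ (1 - d) * m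
  · calc _ ≤ ((2 ^ (r * n) : ℕ) : ℝ) := by exact_mod_cast hb1
      _ = (2 : ℝ) ^ ((r : ℝ) * n) := by
        rw [← Nat.cast_mul, Real.rpow_natCast]
        push_cast
        rfl
      _ ≤ _ := Real.rpow_le_rpow_of_exponent_le (by norm_num)
        (mul_le_mul_of_nonneg_right hcase hn0)
  · push Not at hcase
    have hm4 : (m : ℝ) ≤ 4 * n := by nlinarith
    have hrn : (1 + γ / 2) * n ≤ r := by
      have h1 : (1 - γ / 4) * ((1 + γ) * n) ≤ (1 - d) * m := by
        apply mul_le_mul (by linarith) hmn (by positivity) hd2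
      have h2 : (1 + γ / 2) ≤ (1 - γ / 4) * (1 + γ) := by nlinarith
      have h3 := mul_le_mul_of_nonneg_right h2 hn0
      linarith
    set h := ⌊γ * n / 8⌋₊ with hh
    have hle : (h : ℝ) ≤ γ * n / 8 := Nat.floor_le (by positivity)
    have hge : γ * n / 8 < h + 1 := Nat.lt_floor_add_one _
    have hcond : n + 1 + (h + (h + h)) ≤ r := by
      have : (n : ℝ) + 1 + (h + (h + h)) ≤ r := by linarith
      exact_mod_cast this
    have hb := hb2 h hcond
    have h16 : γ * n / 16 ≤ h := by linarith
    have h8 : (8 : ℝ) ≤ h := by linarith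
    have hsq : (γ * n / 16) ^ 2 ≤ (h : ℝ) ^ 2 := pow_le_pow_left₀ (by positivity) h16 2
    have hdm : d * m * n ≤ d * (4 * n) * n := by gcongr
    have hexp : (r : ℝ) * n + 4 * h - h * h ≤ (1 - d) * m * n := by
      have h1 : (r : ℝ) * n ≤ m * n := mul_le_mul_of_nonneg_right hrm' hn0
      have h2 : d * (4 * n) * n = (γ * n / 16) ^ 2 / 2 := by rw [hd]; ring
      nlinarith
    refine le_trans ?_ (Real.rpow_le_rpow_of_exponent_le (by norm_num) hexp)
    rw [Real.rpow_sub (by norm_num), le_div_iff₀ (by positivity)]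
    have e1 : (2 : ℝ) ^ ((h : ℝ) * h) = ((2 ^ (h * h) : ℕ) : ℝ) := by
      rw [← Nat.cast_mul, Real.rpow_natCast]
      push_cast
      rfl
    have e2 : (2 : ℝ) ^ ((r : ℝ) * n + 4 * h) = ((2 ^ (r * n + 4 * h) : ℕ) : ℝ) := by
      have : (r : ℝ) * n + 4 * h = ((r * n + 4 * h : ℕ) : ℝ) := by push_cast; ring
      rw [this, Real.rpow_natCast]
      push_cast
      rfl
    rw [e1, e2]
    exact_mod_cast hb
end

section
/- For every real constant c > 1 there exist a constant d' > 0 and N ∈ ℕ such that for all n ≥ N, every integer m ≥ c·n, and every fixed matrix B ∈ F₂^{m×2n}, the set F_B := {B·A : A ∈ F₂^{2n×n}, A full-rank and isotropic} ⊆ F₂^{m×n} has cardinality |F_B| ≤ 2^{m·n − d'·n²}. -/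
open scoped BigOperators Classical

open Module in
lemma aux_comap {V U : Type*} [AddCommGroup V] [Module (ZMod 2) V] [AddCommGroup U]
    [Module (ZMod 2) U] [FiniteDimensional (ZMod 2) V] [FiniteDimensional (ZMod 2) U]
    (f : V →ₗ[ZMod 2] U) (W : Submodule (ZMod 2) U) :
    finrank (ZMod 2) (W.comap f) ≤ finrank (ZMod 2) W + finrank (ZMod 2) (LinearMap.ker f) := by
  have h := LinearMap.finrank_range_add_finrank_ker (f.domRestrict (W.comap f))
  have h1 : finrank (ZMod 2) (LinearMap.range (f.domRestrict (W.comap f)))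
      ≤ finrank (ZMod 2) W := by
    apply Submodule.finrank_mono
    rintro _ ⟨x, rfl⟩
    exact x.2
  have h2 : finrank (ZMod 2) (LinearMap.ker (f.domRestrict (W.comap f)))
      ≤ finrank (ZMod 2) (LinearMap.ker f) := by
    rw [← Submodule.finrank_map_subtype_eq (W.comap f)
      (LinearMap.ker (f.domRestrict (W.comap f)))]
    apply Submodule.finrank_mono
    rintro _ ⟨x, hx, rfl⟩
    exact hx
  omega

open Module in
lemma aux_card {V : Type*} [AddCommGroup V] [Module (ZMod 2) V] [Fintype V]
    (W : Submodule (ZMod 2) V) :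
    (Finset.univ.filter fun x => x ∈ W).card = 2 ^ finrank (ZMod 2) W := by
  have h := Module.card_eq_pow_finrank (K := ZMod 2) (V := W)
  rw [ZMod.card] at h
  rw [← h, Fintype.card_subtype]

/-- tuples that are isotropic for `φ` and annihilated by `W`. -/
noncomputable def isoTuples {V : Type*} [AddCommGroup V] [Module (ZMod 2) V] [Fintype V]
    (φ : V →ₗ[ZMod 2] Module.Dual (ZMod 2) V) (k : ℕ)
    (W : Submodule (ZMod 2) (Module.Dual (ZMod 2) V)) : Finset (Fin k → V) :=
  Finset.univ.filter fun Y => (∀ i, ∀ w ∈ W, w (Y i) = 0) ∧ ∀ i j, i < j → φ (Y i) (Y j) = 0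

lemma isoTuples_succ {V : Type*} [AddCommGroup V] [Module (ZMod 2) V] [Fintype V]
    (φ : V →ₗ[ZMod 2] Module.Dual (ZMod 2) V) (k : ℕ)
    (W : Submodule (ZMod 2) (Module.Dual (ZMod 2) V)) :
    (isoTuples φ (k+1) W).card ≤
      ∑ y ∈ Finset.univ.filter (fun y => y ∈ W.dualCoannihilator),
        (isoTuples φ k (W ⊔ Submodule.span (ZMod 2) {φ y})).card := by
  rw [← Finset.card_sigma]
  apply Finset.card_le_card_of_injOn (fun Y => ⟨Y 0, fun i => Y i.succ⟩)
  · intro Y hY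
    simp only [isoTuples, Finset.coe_filter, Finset.mem_univ, true_and, Set.mem_ofPred_eq] at hY
    simp only [Finset.coe_sigma, Set.mem_sigma_iff, Finset.coe_filter, Finset.mem_univ, true_and,
      Set.mem_ofPred_eq, isoTuples]
    refine ⟨?_, ?_, ?_⟩
    · rw [Submodule.mem_dualCoannihilator]
      exact hY.1 0
    · intro i w hw
      obtain ⟨w1, h1, w2, h2, rfl⟩ := Submodule.mem_sup.1 hw
      obtain ⟨a, rfl⟩ := Submodule.mem_span_singleton.1 h2
      simp [hY.1 _ _ h1, hY.2 0 i.succ (Fin.succ_pos i)]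
    · intro i j hij
      exact hY.2 _ _ (Fin.succ_lt_succ_iff.2 hij)
  · intro Y _ Z _ h
    simp only [Sigma.mk.injEq, heq_eq_eq] at h
    funext i
    refine Fin.cases h.1 (fun i => congrFun h.2 i) i

open Module in
lemma isoTuples_card {V : Type*} [AddCommGroup V] [Module (ZMod 2) V] [Fintype V]
    (φ : V →ₗ[ZMod 2] Module.Dual (ZMod 2) V) (k : ℕ) :
    ∀ (q : ℕ) (W : Submodule (ZMod 2) (Module.Dual (ZMod 2) V)), finrank (ZMod 2) W = q →
      2 * (q + k) ≤ finrank (ZMod 2) (LinearMap.range φ) →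
      (isoTuples φ k W).card * 2 ^ (k * q + k.choose 2) ≤ 2 ^ ((finrank (ZMod 2) V + 1) * k) := by
  induction k with
  | zero =>
    intro q W hW hR
    have : (isoTuples φ 0 W).card ≤ 1 := Finset.card_le_one_of_subsingleton _
    simpa using this
  | succ k ih =>
    intro q W hW hR
    set m := finrank (ZMod 2) V with hm
    set R := finrank (ZMod 2) (LinearMap.range φ) with hRdef
    set P := Finset.univ.filter (fun y => y ∈ W.dualCoannihilator) with hP
    have hPc : P.card * 2 ^ q = 2 ^ m := by
      rw [hP, aux_card, ← pow_add, ← hW, add_comm,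
        Subspace.finrank_add_finrank_dualCoannihilator_eq]
    have hQc : (Finset.univ.filter (fun y => y ∈ W.comap φ)).card * 2 ^ (q + k) ≤ 2 ^ m := by
      rw [aux_card, ← pow_add]
      apply Nat.pow_le_pow_right (by norm_num)
      have := aux_comap φ W
      have := LinearMap.finrank_range_add_finrank_ker φ
      omega
    have key : ∀ y ∈ P, (isoTuples φ k (W ⊔ Submodule.span (ZMod 2) {φ y})).card *
        2 ^ ((k+1) * q + (k+1).choose 2) ≤
        2 ^ ((m + 1) * k) * 2 ^ q + (if y ∈ W.comap φ then 2 ^ ((m + 1) * k) * 2 ^ (q + k) else 0) := by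
      intro y _
      have hch : (k+1).choose 2 = k + k.choose 2 := by
        rw [Nat.choose_succ_succ' k 1, Nat.choose_one_right]
      split_ifs with hy
      · have hsup : W ⊔ Submodule.span (ZMod 2) {φ y} = W := by
          rw [sup_eq_left, Submodule.span_singleton_le_iff_mem]; exact hy
        rw [hsup]
        have h := ih q W hW (by omega)
        calc _ = ((isoTuples φ k W).card * 2 ^ (k * q + k.choose 2)) * 2 ^ (q + k) := by
              rw [hch]; ring
          _ ≤ 2 ^ ((m + 1) * k) * 2 ^ (q + k) := Nat.mul_le_mul_right _ h
          _ ≤ _ := Nat.le_add_left _ _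
      · have hd : finrank (ZMod 2) ↥(W ⊔ Submodule.span (ZMod 2) {φ y}) = q + 1 := by
          apply le_antisymm
          · refine (Submodule.finrank_add_le_finrank_add_finrank _ _).trans ?_
            have : finrank (ZMod 2) (Submodule.span (ZMod 2) {φ y}) ≤ 1 :=
              (finrank_span_le_card {φ y}).trans (by simp)
            omega
          · rw [← hW]
            apply Submodule.finrank_lt_finrank_of_lt
            rw [left_lt_sup, Submodule.span_singleton_le_iff_mem]; exact hy
        have h := ih (q+1) _ hd (by omega)
        calc _ = ((isoTuples φ k (W ⊔ Submodule.span (ZMod 2) {φ y})).card *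
                2 ^ (k * (q+1) + k.choose 2)) * 2 ^ q := by
              rw [hch]; ring
          _ ≤ 2 ^ ((m + 1) * k) * 2 ^ q := Nat.mul_le_mul_right _ h
          _ ≤ _ := Nat.le_add_right _ _
    calc _ ≤ (∑ y ∈ P, (isoTuples φ k (W ⊔ Submodule.span (ZMod 2) {φ y})).card) *
          2 ^ ((k+1) * q + (k+1).choose 2) := Nat.mul_le_mul_right _ (isoTuples_succ φ k W)
      _ ≤ ∑ y ∈ P, (2 ^ ((m + 1) * k) * 2 ^ q +
          (if y ∈ W.comap φ then 2 ^ ((m + 1) * k) * 2 ^ (q + k) else 0)) := by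
          rw [Finset.sum_mul]; exact Finset.sum_le_sum key
      _ ≤ P.card * (2 ^ ((m + 1) * k) * 2 ^ q) +
          (Finset.univ.filter (fun y => y ∈ W.comap φ)).card * (2 ^ ((m + 1) * k) * 2 ^ (q + k)) := by
          rw [Finset.sum_add_distrib, Finset.sum_const, smul_eq_mul]
          apply Nat.add_le_add_left
          refine (Finset.sum_le_sum_of_subset (Finset.subset_univ P)).trans ?_
          rw [← Finset.sum_filter, Finset.sum_const, smul_eq_mul]
      _ = 2 ^ ((m + 1) * k) * (P.card * 2 ^ q) + 2 ^ ((m + 1) * k) *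
          ((Finset.univ.filter (fun y => y ∈ W.comap φ)).card * 2 ^ (q + k)) := by ring
      _ ≤ 2 ^ ((m + 1) * k) * 2 ^ m + 2 ^ ((m + 1) * k) * 2 ^ m :=
          Nat.add_le_add (Nat.mul_le_mul_left _ hPc.le) (Nat.mul_le_mul_left _ hQc)
      _ = _ := by ring

/-- The swap matrix. -/
def Jm (n : ℕ) : Matrix (Fin n ⊕ Fin n) (Fin n ⊕ Fin n) (ZMod 2) := Matrix.fromBlocks 0 1 1 0

lemma Jm_mul (n : ℕ) : Jm n * Jm n = 1 := by
  simp [Jm, Matrix.fromBlocks_multiply, Matrix.fromBlocks_one]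

lemma Jm_tr (n : ℕ) : (Jm n).transpose = Jm n := by
  simp [Jm, Matrix.fromBlocks_transpose]

lemma Jm_det (n : ℕ) : IsUnit (Jm n).det := by
  rw [← Matrix.isUnit_iff_isUnit_det]
  exact IsUnit.of_mul_eq_one _ (Jm_mul n)

lemma iso_mul {n k : ℕ} (A : Matrix (Fin n ⊕ Fin n) (Fin k) (ZMod 2)) (h : IsIsotropic A) :
    A.transpose * (Jm n * A) = 0 := by
  ext i j
  have := h i j
  simp only [symp, Finset.sum_add_distrib] at this
  simp only [Matrix.mul_apply, Jm, Matrix.transpose_apply, Fintype.sum_sum_type, Matrix.zero_apply,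
    Matrix.fromBlocks_apply₁₁, Matrix.fromBlocks_apply₁₂, Matrix.fromBlocks_apply₂₁,
    Matrix.fromBlocks_apply₂₂, Matrix.one_apply]
  simpa using this

open Module in
lemma rank_ker {m n : Type*} [Fintype m] [Fintype n] (A : Matrix m n (ZMod 2)) :
    A.rank + finrank (ZMod 2) (LinearMap.ker A.mulVecLin) = Fintype.card n := by
  have := LinearMap.finrank_range_add_finrank_ker A.mulVecLin
  rw [Module.finrank_fintype_fun_eq_card] at this
  exact this

lemma iso_ker {n m : ℕ} (A : Matrix (Fin n ⊕ Fin n) (Fin n) (ZMod 2)) (h : IsIsotropic A)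
    (hr : A.rank = n) (B : Matrix (Fin m) (Fin n ⊕ Fin n) (ZMod 2)) (y z : Fin m → ZMod 2)
    (hy : (B * A).transpose.mulVec y = 0) (hz : (B * A).transpose.mulVec z = 0) :
    (B * (Jm n * B.transpose)).mulVec y ⬝ᵥ z = 0 := by
  have hk : LinearMap.range (Jm n * A).mulVecLin = LinearMap.ker A.transpose.mulVecLin := by
    apply Submodule.eq_of_le_of_finrank_eq
    · rintro _ ⟨x, rfl⟩
      rw [LinearMap.mem_ker, Matrix.mulVecLin_apply, Matrix.mulVecLin_apply, Matrix.mulVec_mulVec,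
        iso_mul A h, Matrix.zero_mulVec]
    · have h1 := rank_ker A.transpose
      rw [Matrix.rank_transpose, hr] at h1
      have h2 : (Jm n * A).rank = n := by
        rw [Matrix.rank_mul_eq_right_of_isUnit_det _ _ (Jm_det n), hr]
      simp at h1
      unfold Matrix.rank at h2
      omega
  have ex : ∀ y : Fin m → ZMod 2, (B * A).transpose.mulVec y = 0 →
      ∃ x, (Jm n * A).mulVec x = B.transpose.mulVec y := by
    intro y hy
    have : B.transpose.mulVec y ∈ LinearMap.ker A.transpose.mulVecLin := by
      rw [LinearMap.mem_ker, Matrix.mulVecLin_apply, Matrix.mulVec_mulVec,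
        ← Matrix.transpose_mul, hy]
    rw [← hk] at this
    exact this
  obtain ⟨u, hu⟩ := ex y hy
  obtain ⟨v, hv⟩ := ex z hz
  rw [dotProduct_comm, ← Matrix.mulVec_mulVec, Matrix.dotProduct_mulVec, ← Matrix.mulVec_transpose,
    ← hv, ← Matrix.mulVec_mulVec y (Jm n), ← hu, Matrix.mulVec_mulVec u (Jm n), ← Matrix.mul_assoc,
    Jm_mul, Matrix.one_mul, dotProduct_comm, Matrix.dotProduct_mulVec, ← Matrix.mulVec_transpose,
    Matrix.mulVec_mulVec]
  have h2 : (Jm n * A).transpose * A = 0 := by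
    rw [Matrix.transpose_mul, Jm_tr, Matrix.mul_assoc, iso_mul A h]
  rw [h2]
  simp

lemma rank_S {n m : ℕ} (B : Matrix (Fin m) (Fin n ⊕ Fin n) (ZMod 2)) :
    2 * B.rank ≤ (B * (Jm n * B.transpose)).rank + 2 * n := by
  have h1 := rank_ker (B * (Jm n * B.transpose))
  have h2 := rank_ker B
  have h3 := rank_ker (Jm n * B.transpose)
  have h4 := aux_comap (Jm n * B.transpose).mulVecLin (LinearMap.ker B.mulVecLin)
  rw [← LinearMap.ker_comp, ← Matrix.mulVecLin_mul] at h4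
  rw [Matrix.rank_mul_eq_right_of_isUnit_det _ _ (Jm_det n), Matrix.rank_transpose] at h3
  simp at h1 h2 h3
  omega

/-- rank bound on the image -/
lemma card_rank {n m : ℕ} (B : Matrix (Fin m) (Fin n ⊕ Fin n) (ZMod 2)) :
    ((fullRankIso n n).image fun A => B * A).card ≤ 2 ^ (B.rank * n) := by
  have h : (Fintype.piFinset fun _ : Fin n =>
      Finset.univ.filter fun x => x ∈ LinearMap.range B.mulVecLin).card = 2 ^ (B.rank * n) := by
    rw [Fintype.card_piFinset]
    simp only [aux_card, Finset.prod_const, Finset.card_univ, Fintype.card_fin]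
    rw [← pow_mul]; rfl
  rw [← h]
  apply Finset.card_le_card_of_injOn (fun M => M.transpose)
  · intro M hM
    simp only [Finset.coe_image, Set.mem_image] at hM
    obtain ⟨A, _, rfl⟩ := hM
    refine Finset.mem_coe.2 (Fintype.mem_piFinset.2 fun j => ?_)
    simp only [Finset.mem_filter, Finset.mem_univ, true_and]
    exact ⟨fun r => A r j, by ext i; simp [Matrix.mulVec, dotProduct, Matrix.mul_apply]⟩
  · intro M _ N _ h
    exact Matrix.transpose_injective h

/-- number of matrices killed by an independent tuple -/
lemma card_killed {n m l : ℕ} (Y : Fin l → Fin m → ZMod 2) (hY : LinearIndependent (ZMod 2) Y) :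
    (Finset.univ.filter fun M : Matrix (Fin m) (Fin n) (ZMod 2) =>
      ∀ i, M.transpose.mulVec (Y i) = 0).card * 2 ^ (l * n) ≤ 2 ^ (m * n) := by
  have hr : (Matrix.of Y).rank = l := by
    have := LinearIndependent.rank_matrix (M := Matrix.of Y) hY
    simpa using this
  have hk := rank_ker (Matrix.of Y)
  rw [hr, Fintype.card_fin] at hk
  have h : (Fintype.piFinset fun _ : Fin n =>
      Finset.univ.filter fun x => x ∈ LinearMap.ker (Matrix.of Y).mulVecLin).card
        * 2 ^ (l * n) = 2 ^ (m * n) := by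
    rw [Fintype.card_piFinset]
    simp only [aux_card, Finset.prod_const, Finset.card_univ, Fintype.card_fin]
    rw [← pow_mul, ← pow_add, ← add_mul, add_comm, hk]
  rw [← h]
  apply Nat.mul_le_mul_right
  apply Finset.card_le_card_of_injOn (fun M => M.transpose)
  · intro M hM
    simp only [Finset.coe_filter, Finset.mem_univ, true_and, Set.mem_ofPred_eq] at hM
    refine Finset.mem_coe.2 (Fintype.mem_piFinset.2 fun j => ?_)
    simp only [Finset.mem_filter, Finset.mem_univ, true_and]
    rw [LinearMap.mem_ker]
    ext i
    have := congrFun (hM i) j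
    simp only [Matrix.mulVec, dotProduct, Matrix.transpose_apply, Pi.zero_apply] at this
    simpa [Matrix.mulVec, dotProduct, mul_comm] using this
  · intro M _ N _ h
    exact Matrix.transpose_injective h

open Module in
/-- many independent tuples in the kernel -/
lemma card_indep {V : Type*} [AddCommGroup V] [Module (ZMod 2) V] [Fintype V] (l e : ℕ)
    (K : Submodule (ZMod 2) V) (hl : l ≤ e) (he : e ≤ finrank (ZMod 2) K) :
    2 ^ (e * l) ≤ (Finset.univ.filter fun Y : Fin l → V =>
      LinearIndependent (ZMod 2) Y ∧ ∀ i, Y i ∈ K).card * 2 ^ l := by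
  have h := card_linearIndependent (K := ZMod 2) (V := K) (k := l) (hl.trans he)
  rw [ZMod.card] at h
  have h1 : 2 ^ (e * l) ≤ (∏ i : Fin l, (2 ^ finrank (ZMod 2) K - 2 ^ i.val)) * 2 ^ l := by
    calc 2 ^ (e * l) = ∏ i : Fin l, 2 ^ e := by simp [pow_mul]
      _ ≤ ∏ i : Fin l, ((2 ^ finrank (ZMod 2) K - 2 ^ i.val) * 2) := by
        apply Finset.prod_le_prod' 
        intro i _
        have h1 : 2 ^ (i.val + 1) ≤ 2 ^ finrank (ZMod 2) K :=
          Nat.pow_le_pow_right (by norm_num) (by omega)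
        have h2 : 2 ^ e ≤ 2 ^ finrank (ZMod 2) K := Nat.pow_le_pow_right (by norm_num) he
        rw [pow_succ] at h1
        omega
      _ = _ := by rw [Finset.prod_mul_distrib]; simp
  refine h1.trans (Nat.mul_le_mul_right _ ?_)
  rw [← h, ← Fintype.card_subtype, ← Nat.card_eq_fintype_card]
  apply Nat.card_le_card_of_injective
    (fun s : {s : Fin l → K // LinearIndependent (ZMod 2) s} =>
      (⟨fun i => (s.1 i : V), s.2.map' K.subtype K.ker_subtype, fun i => (s.1 i).2⟩ :
        {Y : Fin l → V // LinearIndependent (ZMod 2) Y ∧ ∀ i, Y i ∈ K}))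
  intro s t hst
  ext i
  have := congrArg Subtype.val hst
  exact congrFun this i

open Module in
lemma main_card {n m l : ℕ} (B : Matrix (Fin m) (Fin n ⊕ Fin n) (ZMod 2)) (hnm : n + l ≤ m)
    (hl : l + n ≤ B.rank) :
    ((fullRankIso n n).image fun A => B * A).card * 2 ^ (l.choose 2) ≤ 2 ^ (m * n + 2 * l) := by
  set F := (fullRankIso n n).image fun A => B * A with hF
  set S := B * (Jm n * B.transpose) with hS
  set φ : (Fin m → ZMod 2) →ₗ[ZMod 2] Dual (ZMod 2) (Fin m → ZMod 2) :=
    (dotProductEquiv (ZMod 2) (Fin m)).toLinearMap ∘ₗ S.mulVecLin with hφ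
  have hφa : ∀ y z, φ y z = S.mulVec y ⬝ᵥ z := fun y z => rfl
  have hφr : finrank (ZMod 2) (LinearMap.range φ) = S.rank := by
    rw [hφ, LinearMap.range_comp, LinearEquiv.finrank_map_eq]; rfl
  have hT := isoTuples_card φ l 0 ⊥ (by simp) (by have := rank_S B; rw [← hS] at this; rw [hφr]; omega)
  rw [Module.finrank_fintype_fun_eq_card, Fintype.card_fin] at hT
  set T := isoTuples φ l ⊥ with hTd
  -- double counting
  set G := T.filter (fun Y => LinearIndependent (ZMod 2) Y) with hG
  have hdc := Finset.sum_card_bipartiteAbove_eq_sum_card_bipartiteBelow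
    (s := F) (t := G) (fun M Y => ∀ i, M.transpose.mulVec (Y i) = 0)
  have lo : F.card * 2 ^ ((m - n) * l) ≤ (∑ M ∈ F, (Finset.bipartiteAbove
      (fun (M : Matrix (Fin m) (Fin n) (ZMod 2)) (Y : Fin l → Fin m → ZMod 2) =>
        ∀ i, M.transpose.mulVec (Y i) = 0) G M).card) * 2 ^ l := by
    rw [Finset.sum_mul, ← smul_eq_mul, ← Finset.sum_const]
    apply Finset.sum_le_sum
    intro M hM
    obtain ⟨A, hA, rfl⟩ := Finset.mem_image.1 hM
    simp only [fullRankIso, Finset.mem_filter, Finset.mem_univ, true_and] at hA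
    have hk := rank_ker (B * A).transpose
    have hk2 := Matrix.rank_le_height (B * A).transpose
    rw [Fintype.card_fin] at hk
    refine (card_indep l (m - n) (LinearMap.ker (B * A).transpose.mulVecLin)
      (by omega) (by omega)).trans ?_
    apply Nat.mul_le_mul_right
    apply Finset.card_le_card
    intro Y hY
    simp only [Finset.mem_filter, Finset.mem_univ, true_and, LinearMap.mem_ker,
      Matrix.mulVecLin_apply] at hY
    simp only [Finset.mem_bipartiteAbove, hG, hTd, isoTuples, Finset.mem_filter, Finset.mem_univ,
      true_and]
    refine ⟨⟨⟨?_, ?_⟩, hY.1⟩, hY.2⟩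
    · intro i w hw
      rw [Submodule.mem_bot] at hw
      simp [hw]
    · intro i j _
      rw [hφa]
      exact iso_ker A hA.2 hA.1 B _ _ (hY.2 i) (hY.2 j)
  have hi : (∑ Y ∈ G, (Finset.bipartiteBelow
      (fun (M : Matrix (Fin m) (Fin n) (ZMod 2)) (Y : Fin l → Fin m → ZMod 2) =>
        ∀ i, M.transpose.mulVec (Y i) = 0) F Y).card) * 2 ^ (l * n) ≤ T.card * 2 ^ (m * n) := by
    rw [Finset.sum_mul]
    calc _ ≤ ∑ Y ∈ G, 2 ^ (m * n) := by
          apply Finset.sum_le_sum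
          intro Y hY
          refine le_trans (Nat.mul_le_mul_right _ (Finset.card_le_card ?_))
            (card_killed (n := n) Y (Finset.mem_filter.1 hY).2)
          intro M hM
          simpa using (Finset.mem_filter.1 hM).2
      _ = G.card * 2 ^ (m * n) := by simp
      _ ≤ _ := Nat.mul_le_mul_right _ (Finset.card_le_card (Finset.filter_subset _ _))
  rw [hdc] at lo
  obtain ⟨e, rfl⟩ : ∃ e, m = n + e := ⟨m - n, by omega⟩
  rw [Nat.add_sub_cancel_left] at lo
  generalize (∑ Y ∈ G, (Finset.bipartiteBelow
      (fun (M : Matrix (Fin (n + e)) (Fin n) (ZMod 2)) (Y : Fin l → Fin (n + e) → ZMod 2) =>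
        ∀ i, M.transpose.mulVec (Y i) = 0) F Y).card) = X at lo hi
  have : (F.card * 2 ^ l.choose 2) * 2 ^ (e * l + l * n) ≤
      2 ^ ((n + e) * n + 2 * l) * 2 ^ (e * l + l * n) := by
    calc _ = (F.card * 2 ^ (e * l)) * (2 ^ l.choose 2 * 2 ^ (l * n)) := by ring
      _ ≤ _ := Nat.mul_le_mul_right _ lo
      _ = X * 2 ^ (l * n) * (2 ^ l.choose 2 * 2 ^ l) := by ring
      _ ≤ _ := Nat.mul_le_mul_right _ hi
      _ = (T.card * 2 ^ (l * 0 + l.choose 2)) * (2 ^ ((n + e) * n) * 2 ^ l) := by ring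
      _ ≤ _ := Nat.mul_le_mul_right _ hT
      _ = _ := by ring
  exact Nat.le_of_mul_le_mul_right this (by positivity)

/-- For every `c > 1` there are `d' > 0` and `N` such that for all `n ≥ N`, every
`m ≥ c·n` and every fixed `B ∈ F₂^{m×2n}`, the set
`F_B = {B·A : A full-rank isotropic in F₂^{2n×n}}` has cardinality at most
`2^{mn - d'·n²}`. -/
theorem stmt3 (c : ℝ) (hc : 1 < c) :
    ∃ d' : ℝ, 0 < d' ∧ ∃ N : ℕ, ∀ n : ℕ, N ≤ n → ∀ m : ℕ, c * n ≤ (m : ℝ) →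
      ∀ B : Matrix (Fin m) (Fin n ⊕ Fin n) (ZMod 2),
        (((fullRankIso n n).image fun A => B * A).card : ℝ)
          ≤ (2 : ℝ) ^ ((m : ℝ) * (n : ℝ) - d' * (n : ℝ) ^ 2) := by
  obtain ⟨δ, hδ, rfl⟩ : ∃ δ : ℝ, 0 < δ ∧ c = 1 + 2 * δ := ⟨(c - 1) / 2, by linarith, by ring⟩
  refine ⟨min δ (δ ^ 2 / 16), by positivity, ⌈20 / δ⌉₊, ?_⟩
  intro n hn m hm B
  have hn' : 20 / δ ≤ n := (Nat.le_ceil _).trans (by exact_mod_cast hn)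
  rw [div_le_iff₀ hδ] at hn'
  have hn2 : (0 : ℝ) ≤ (n : ℝ) ^ 2 := by positivity
  have hd1 : min δ (δ ^ 2 / 16) * (n : ℝ) ^ 2 ≤ δ * (n : ℝ) ^ 2 :=
    mul_le_mul_of_nonneg_right (min_le_left _ _) hn2
  have hd2 : min δ (δ ^ 2 / 16) * (n : ℝ) ^ 2 ≤ δ ^ 2 / 16 * (n : ℝ) ^ 2 :=
    mul_le_mul_of_nonneg_right (min_le_right _ _) hn2
  by_cases hr : (B.rank : ℝ) ≤ m - δ * n
  · have h := card_rank B
    have h' : (((fullRankIso n n).image fun A => B * A).card : ℝ) ≤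
        (2 : ℝ) ^ ((B.rank * n : ℕ) : ℝ) := by
      rw [Real.rpow_natCast]; exact_mod_cast h
    refine h'.trans (Real.rpow_le_rpow_of_exponent_le (by norm_num) ?_)
    push_cast
    nlinarith [mul_le_mul_of_nonneg_right hr (Nat.cast_nonneg (α := ℝ) n)]
  · push Not at hr
    set l := ⌊δ * n⌋₊ with hl
    have hl1 : (l : ℝ) ≤ δ * n := Nat.floor_le (by positivity)
    have hl2 : δ * n < l + 1 := Nat.lt_floor_add_one _
    have h := main_card (n := n) (m := m) (l := l) B
      (by have : (n : ℝ) + l ≤ m := by nlinarith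
          exact_mod_cast this)
      (by have : (l : ℝ) + n ≤ B.rank := by nlinarith
          exact_mod_cast this)
    have h' : (((fullRankIso n n).image fun A => B * A).card : ℝ) * (2 : ℝ) ^ ((l.choose 2 : ℕ) : ℝ)
        ≤ (2 : ℝ) ^ ((m * n + 2 * l : ℕ) : ℝ) := by
      rw [Real.rpow_natCast, Real.rpow_natCast]; exact_mod_cast h
    rw [← le_div_iff₀ (by positivity), ← Real.rpow_sub (by norm_num)] at h'
    refine h'.trans (Real.rpow_le_rpow_of_exponent_le (by norm_num) ?_)
    rw [Nat.cast_choose_two]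
    push_cast
    have hl3 : (19 : ℝ) ≤ l := by linarith
    have hl4 : δ * n / 2 ≤ l := by linarith
    have hsq : (δ * n / 2) ^ 2 ≤ (l : ℝ) ^ 2 := by gcongr
    nlinarith
end

section
/- Let c > 1, K ≥ 1 and δ > 0 be real constants, let (m_n) be a sequence of positive integers with c·n ≤ m_n ≤ n^K for all n ≥ 2, and let (p_n) be a sequence in (0, 3/4] with n·p_n → ∞. For each n, let A_n be uniformly distributed over the full-rank isotropic matrices in F₂^{2n×n} and let B_n be a random matrix in F₂^{m_n×2n} independent of A_n. If the total variation distance between the law of B_n·A_n and the uniform distribution on F₂^{m_n×n} is a negligible function of n, then the probability of the event that E_{e∼D_{p_n}^{⊗n}}[|B_n·e|] < ((1 − n/m_n − δ)/2)·m_n (the expectation being over e only, for the realized B_n) is also a negligible function of n. -/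
open scoped BigOperators Classical

/-- Probability of a single pair under the depolarizing distribution `D_p`. -/
noncomputable def pairProb (p : ℝ) (a b : ZMod 2) : ℝ :=
  if a = 0 ∧ b = 0 then 1 - p else p / 3

/-- Density of the depolarizing distribution `D_p^{⊗n}` on `F₂^{2n}`. -/
noncomputable def depDensity (p : ℝ) (n : ℕ) (e : (Fin n ⊕ Fin n) → ZMod 2) : ℝ :=
  ∏ j : Fin n, pairProb p (e (Sum.inl j)) (e (Sum.inr j))

/-- Hamming weight of a vector over `F₂`. -/
def hWt {ι : Type*} [Fintype ι] (v : ι → ZMod 2) : ℕ :=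
  (Finset.univ.filter fun i => v i ≠ 0).card

/-- A function `ν : ℕ → ℝ` is negligible if for every `k` it is eventually at most
`n^{-k}`. -/
def Negligible (ν : ℕ → ℝ) : Prop :=
  ∀ k : ℕ, ∃ N : ℕ, ∀ n : ℕ, N ≤ n → ν n ≤ 1 / (n : ℝ) ^ k

namespace Stmt4Aux

abbrev F := ZMod 2

section linalg

variable {V U : Type*} [AddCommGroup V] [Module F V] [AddCommGroup U] [Module F U]

lemma finrank_le_map_add_ker [FiniteDimensional F V] (f : V →ₗ[F] U) (p : Submodule F V) :
    Module.finrank F p ≤ Module.finrank F (p.map f) + Module.finrank F (LinearMap.ker f) := by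
  have h := LinearMap.finrank_range_add_finrank_ker (f.domRestrict p)
  rw [LinearMap.range_domRestrict] at h
  have h2 : Module.finrank F (LinearMap.ker (f.domRestrict p)) ≤
      Module.finrank F (LinearMap.ker f) := by
    let g : LinearMap.ker (f.domRestrict p) →ₗ[F] LinearMap.ker f :=
      { toFun := fun x => ⟨x.1.1, x.2⟩
        map_add' := fun x y => rfl
        map_smul' := fun c x => rfl }
    apply LinearMap.finrank_le_finrank_of_injective (f := g)
    intro x y hxy
    have := congrArg Subtype.val hxy
    exact Subtype.ext (Subtype.ext this)
  omega

lemma natCard_eq [Finite V] : Nat.card V = 2 ^ Module.finrank F V := by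
  have := Module.natCard_eq_pow_finrank (K := F) (V := V)
  simpa using this

lemma comap_card [Fintype V] [Finite U] (g : V →ₗ[F] U) (a : ℕ) (W : Submodule F U)
    (h : Module.finrank F W + a ≤ Module.finrank F (LinearMap.range g)) :
    ((Finset.univ.filter fun y : V => g y ∈ W).card : ℝ) ≤
      (Fintype.card V : ℝ) * ((2 : ℝ) ^ a)⁻¹ := by
  have : FiniteDimensional F V := Module.Finite.of_finite
  have : FiniteDimensional F U := Module.Finite.of_finite
  have h1 := finrank_le_map_add_ker g (W.comap g)
  have h2 : Module.finrank F ((W.comap g).map g) ≤ Module.finrank F W :=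
    Submodule.finrank_mono (Submodule.map_comap_le g W)
  have h3 := LinearMap.finrank_range_add_finrank_ker g
  have h4 : (Finset.univ.filter fun y : V => g y ∈ W).card = Nat.card (W.comap g) := by
    rw [← Fintype.card_subtype, ← Nat.card_eq_fintype_card]; rfl
  rw [h4, natCard_eq, ← Nat.card_eq_fintype_card, natCard_eq (V := V)]
  rw [← div_eq_mul_inv, le_div_iff₀ (by positivity)]
  push_cast
  rw [← pow_add]
  exact pow_le_pow_right₀ (by norm_num) (by omega)

lemma tuple_sum [Fintype V] [Finite U] (g : V →ₗ[F] U) (a : ℕ) : ∀ (i : ℕ) (W : Submodule F U),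
    Module.finrank F W + i + a ≤ Module.finrank F (LinearMap.range g) →
    ∑ Y : Fin i → V, ((2 : ℝ) ^ a)⁻¹ ^
        Module.finrank F ↥(W ⊔ Submodule.span F (Set.range (g ∘ Y))) ≤
      (Fintype.card V : ℝ) ^ i * ((2 : ℝ) ^ a)⁻¹ ^ Module.finrank F W *
        (2 * ((2 : ℝ) ^ a)⁻¹) ^ i := by
  have : FiniteDimensional F V := Module.Finite.of_finite
  have : FiniteDimensional F U := Module.Finite.of_finite
  intro i
  induction i with
  | zero =>
    intro W _
    have e0 : ∀ Y : Fin 0 → V, Module.finrank F ↥(W ⊔ Submodule.span F (Set.range (g ∘ Y))) =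
        Module.finrank F W := by
      intro Y
      rw [Set.range_eq_empty, Submodule.span_empty, sup_bot_eq]
    simp only [e0]
    simp
  | succ i ih =>
    intro W hW
    set x : ℝ := ((2 : ℝ) ^ a)⁻¹ with hx
    have hx0 : 0 < x := by positivity
    rw [← (Fin.consEquiv (fun _ => V)).sum_comp, Fintype.sum_prod_type]
    have key : ∀ y : V, ∑ Y : Fin i → V, x ^ Module.finrank F
        ↥(W ⊔ Submodule.span F (Set.range (g ∘ (Fin.consEquiv (fun _ => V)) (y, Y)))) ≤
        (Fintype.card V : ℝ) ^ i * (2 * x) ^ i * (x ^ Module.finrank F W *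
          ((if g y ∈ W then 1 else 0) + x)) := by
      intro y
      have e : ∀ Y : Fin i → V,
          W ⊔ Submodule.span F (Set.range (g ∘ (Fin.consEquiv (fun _ => V)) (y, Y))) =
          (W ⊔ Submodule.span F {g y}) ⊔ Submodule.span F (Set.range (g ∘ Y)) := by
        intro Y
        have : Set.range (g ∘ (Fin.consEquiv (fun _ => V)) (y, Y)) =
            {g y} ∪ Set.range (g ∘ Y) := by
          ext z
          simp [Fin.exists_fin_succ, Fin.consEquiv, eq_comm]
        rw [this, Submodule.span_union, sup_assoc]
      have e' : ∀ Y : Fin i → V, Module.finrank F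
          ↥(W ⊔ Submodule.span F (Set.range (g ∘ (Fin.consEquiv (fun _ => V)) (y, Y)))) =
          Module.finrank F
          ↥((W ⊔ Submodule.span F {g y}) ⊔ Submodule.span F (Set.range (g ∘ Y))) :=
        fun Y => by rw [e Y]
      simp only [e']
      have hle : Module.finrank F ↥(W ⊔ Submodule.span F {g y}) ≤ Module.finrank F W + 1 := by
        refine (Submodule.finrank_add_le_finrank_add_finrank _ _).trans ?_
        have := finrank_span_le_card (R := F) ({g y} : Set U)
        simp at this
        omega
      refine (ih _ (by omega)).trans ?_
      have : x ^ Module.finrank F ↥(W ⊔ Submodule.span F {g y}) ≤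
          x ^ Module.finrank F W * ((if g y ∈ W then 1 else 0) + x) := by
        split_ifs with hy
        · have : W ⊔ Submodule.span F {g y} = W := by
            rw [sup_eq_left, Submodule.span_singleton_le_iff_mem]; exact hy
          rw [this]
          have := pow_pos hx0 (Module.finrank F W)
          nlinarith
        · have : Module.finrank F W < Module.finrank F ↥(W ⊔ Submodule.span F {g y}) := by
            apply Submodule.finrank_lt_finrank_of_lt
            rw [left_lt_sup, Submodule.span_singleton_le_iff_mem]; exact hy
          have : Module.finrank F ↥(W ⊔ Submodule.span F {g y}) = Module.finrank F W + 1 := by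
            omega
          rw [this, pow_succ]; simp
      calc _ = (Fintype.card V : ℝ) ^ i * (2 * x) ^ i *
              x ^ Module.finrank F ↥(W ⊔ Submodule.span F {g y}) := by ring
        _ ≤ _ := by gcongr
    refine (Finset.sum_le_sum fun y _ => key y).trans ?_
    rw [← Finset.mul_sum, ← Finset.mul_sum, Finset.sum_add_distrib, Finset.sum_boole]
    have hc := comap_card g a W (by omega)
    rw [← hx] at hc
    simp only [Finset.sum_const, Finset.card_univ, nsmul_eq_mul]
    calc _ ≤ (Fintype.card V : ℝ) ^ i * (2 * x) ^ i * (x ^ Module.finrank F W *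
          ((Fintype.card V : ℝ) * x + (Fintype.card V : ℝ) * x)) := by gcongr
      _ = _ := by ring

lemma pair_count [Fintype V] (g : V →ₗ[F] Module.Dual F V) (a : ℕ)
    (h : a + a ≤ Module.finrank F (LinearMap.range g)) :
    (Finset.univ.filter fun Y : (Fin a → V) × (Fin a → V) =>
        ∀ i j, g (Y.1 i) (Y.2 j) = 0).card * 2 ^ (a * a) ≤ Fintype.card V ^ (a + a) * 2 ^ a := by
  have : FiniteDimensional F V := Module.Finite.of_finite
  have : Finite (Module.Dual F V) := Module.finite_of_finite F
  have h1 := tuple_sum g a a ⊥ (by simpa using h)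
  have h2 : ∀ Y1 : Fin a → V,
      ((Finset.univ.filter fun Y2 : Fin a → V => ∀ i j, g (Y1 i) (Y2 j) = 0).card : ℝ) =
      (Fintype.card V : ℝ) ^ a * ((2 : ℝ) ^ a)⁻¹ ^
        Module.finrank F ↥((⊥ : Submodule F (Module.Dual F V)) ⊔
          Submodule.span F (Set.range (g ∘ Y1))) := by
    intro Y1
    set W := Submodule.span F (Set.range (g ∘ Y1)) with hW
    have e : (Finset.univ.filter fun Y2 : Fin a → V => ∀ i j, g (Y1 i) (Y2 j) = 0) =
        Fintype.piFinset (fun _ : Fin a =>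
          Finset.univ.filter fun y : V => y ∈ W.dualCoannihilator) := by
      ext Y2
      simp only [Finset.mem_filter, Finset.mem_univ, true_and, Fintype.mem_piFinset]
      have : ∀ y : V, y ∈ W.dualCoannihilator ↔ ∀ i, g (Y1 i) y = 0 := by
        intro y
        rw [Submodule.mem_dualCoannihilator]
        constructor
        · intro hh i
          exact hh _ (Submodule.subset_span ⟨i, rfl⟩)
        · intro hh φ hφ
          induction hφ using Submodule.span_induction with
          | mem x hx => obtain ⟨i, rfl⟩ := hx; exact hh i
          | zero => simp
          | add x y _ _ hx hy => simp [hx, hy]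
          | smul c x _ hx => simp [hx]
      simp only [this]
      exact forall_comm
    rw [e, Fintype.card_piFinset]
    have h4 : (Finset.univ.filter fun y : V => y ∈ W.dualCoannihilator).card =
        Nat.card W.dualCoannihilator := by
      rw [← Fintype.card_subtype, ← Nat.card_eq_fintype_card]
    have h5 := Subspace.finrank_add_finrank_dualCoannihilator_eq W
    simp only [h4, natCard_eq, Finset.prod_const, Finset.card_univ, Fintype.card_fin]
    rw [bot_sup_eq]
    rw [← Nat.card_eq_fintype_card, natCard_eq (V := V), ← h5]
    push_cast
    rw [inv_pow, ← pow_mul, ← pow_mul, ← pow_mul, ← div_eq_mul_inv, eq_div_iff (by positivity),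
      ← pow_add]
    congr 1; ring
  have h3 : ((Finset.univ.filter fun Y : (Fin a → V) × (Fin a → V) =>
        ∀ i j, g (Y.1 i) (Y.2 j) = 0).card : ℝ) =
      ∑ Y1 : Fin a → V,
        ((Finset.univ.filter fun Y2 : Fin a → V => ∀ i j, g (Y1 i) (Y2 j) = 0).card : ℝ) := by
    simp only [← Finset.sum_boole]
    rw [Fintype.sum_prod_type]
  have h6 : ((Finset.univ.filter fun Y : (Fin a → V) × (Fin a → V) =>
        ∀ i j, g (Y.1 i) (Y.2 j) = 0).card : ℝ) * 2 ^ (a * a) ≤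
        (Fintype.card V : ℝ) ^ (a + a) * 2 ^ a := by
    rw [h3]
    simp only [h2]
    rw [← Finset.mul_sum]
    calc _ ≤ (Fintype.card V : ℝ) ^ a * ((Fintype.card V : ℝ) ^ a *
          ((2 : ℝ) ^ a)⁻¹ ^ Module.finrank F (⊥ : Submodule F (Module.Dual F V)) *
        (2 * ((2 : ℝ) ^ a)⁻¹) ^ a) * 2 ^ (a * a) := by gcongr
      _ = _ := by
        rw [finrank_bot, pow_zero, mul_pow, pow_add, inv_pow, ← pow_mul]
        field_simp
  exact_mod_cast h6

end linalg

section symplectic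

/-- Swapping the two halves of `F₂^{2n}`. -/
noncomputable def swapE (n : ℕ) : (Fin n ⊕ Fin n → F) ≃ₗ[F] (Fin n ⊕ Fin n → F) :=
  LinearEquiv.funCongrLeft F F (Equiv.sumComm (Fin n) (Fin n))

lemma symp_eq {n : ℕ} (u v : Fin n ⊕ Fin n → F) : symp u v = (swapE n u) ⬝ᵥ v := by
  simp only [symp, dotProduct, Fintype.sum_sum_type, swapE, LinearEquiv.funCongrLeft_apply,
    LinearMap.funLeft_apply, Equiv.sumComm_apply, Sum.swap_inl, Sum.swap_inr,
    Finset.sum_add_distrib]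
  rw [add_comm]

lemma swap_swap {n : ℕ} (u : Fin n ⊕ Fin n → F) : swapE n (swapE n u) = u := by
  ext i
  simp [swapE, LinearEquiv.funCongrLeft_apply, LinearMap.funLeft_apply]

lemma dot_swap {n : ℕ} (u v : Fin n ⊕ Fin n → F) :
    (swapE n u) ⬝ᵥ (swapE n v) = u ⬝ᵥ v := by
  simp only [dotProduct, Fintype.sum_sum_type, swapE, LinearEquiv.funCongrLeft_apply,
    LinearMap.funLeft_apply, Equiv.sumComm_apply, Sum.swap_inl, Sum.swap_inr]
  rw [add_comm]

/-- The form `(y, y') ↦ symp (Bᵀ y) (Bᵀ y')`. -/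
noncomputable def form {n s : ℕ} (B : Matrix (Fin s) (Fin n ⊕ Fin n) F) :
    (Fin s → F) →ₗ[F] Module.Dual F (Fin s → F) :=
  (Matrix.mulVecLin B.transpose).dualMap ∘ₗ
    ((dotProductEquiv F (Fin n ⊕ Fin n)).toLinearMap ∘ₗ (swapE n).toLinearMap ∘ₗ
      (Matrix.mulVecLin B.transpose))

lemma form_apply {n s : ℕ} (B : Matrix (Fin s) (Fin n ⊕ Fin n) F) (y y' : Fin s → F) :
    form B y y' = symp (B.transpose.mulVec y) (B.transpose.mulVec y') := by
  rw [symp_eq]; rfl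

lemma form_rank {n s : ℕ} (B : Matrix (Fin s) (Fin n ⊕ Fin n) F) (a : ℕ) (h : n + a ≤ B.rank) :
    a + a ≤ Module.finrank F (LinearMap.range (form B)) := by
  have hr : Module.finrank F (LinearMap.range (Matrix.mulVecLin B.transpose)) = B.rank := by
    rw [← Matrix.rank_transpose B]; rfl
  have h1 := LinearMap.finrank_range_add_finrank_ker (Matrix.mulVecLin B.transpose).dualMap
  rw [LinearMap.finrank_range_dualMap_eq_finrank_range, hr, Subspace.dual_finrank_eq] at h1
  have h2 := finrank_le_map_add_ker (Matrix.mulVecLin B.transpose).dualMap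
    (LinearMap.range ((dotProductEquiv F (Fin n ⊕ Fin n)).toLinearMap ∘ₗ
      (swapE n).toLinearMap ∘ₗ (Matrix.mulVecLin B.transpose)))
  rw [← LinearMap.range_comp] at h2
  change _ ≤ Module.finrank F (LinearMap.range (form B)) + _ at h2
  have h3 : Module.finrank F (LinearMap.range ((dotProductEquiv F (Fin n ⊕ Fin n)).toLinearMap ∘ₗ
      (swapE n).toLinearMap ∘ₗ (Matrix.mulVecLin B.transpose))) = B.rank := by
    rw [LinearMap.range_comp, LinearEquiv.finrank_map_eq, LinearMap.range_comp,
      LinearEquiv.finrank_map_eq, hr]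
  rw [h3] at h2
  simp only [Module.finrank_fintype_fun_eq_card, Fintype.card_sum, Fintype.card_fin] at h1
  omega

lemma lagr {n : ℕ} {A : Matrix (Fin n ⊕ Fin n) (Fin n) F} (hA : A ∈ fullRankIso n n)
    {u u' : Fin n ⊕ Fin n → F} (hu : A.transpose.mulVec u = 0)
    (hu' : A.transpose.mulVec u' = 0) : symp u u' = 0 := by
  simp only [fullRankIso, Finset.mem_filter, Finset.mem_univ, true_and] at hA
  obtain ⟨hr, hi⟩ := hA
  have h1 := LinearMap.finrank_range_add_finrank_ker (Matrix.mulVecLin A.transpose)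
  have hr' : Module.finrank F (LinearMap.range (Matrix.mulVecLin A.transpose)) = n := by
    have h0 := Matrix.rank_transpose A
    rw [hr] at h0
    exact h0
  rw [hr'] at h1
  simp only [Module.finrank_fintype_fun_eq_card, Fintype.card_sum, Fintype.card_fin] at h1
  have hiso : ∀ v v' : Fin n → F, symp (A.mulVec v) (A.mulVec v') = 0 := by
    intro v v'
    rw [symp_eq]
    have hcol : ∀ i j, swapE n (A.mulVec (Pi.single i 1)) ⬝ᵥ (A.mulVec (Pi.single j 1)) = 0 := by
      intro i j
      rw [← symp_eq, Matrix.mulVec_single_one, Matrix.mulVec_single_one]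
      exact hi i j
    have e : ∀ v : Fin n → F, A.mulVec v = ∑ i, v i • A.mulVec (Pi.single i 1) := by
      intro v
      conv_lhs => rw [pi_eq_sum_univ' v]
      rw [Matrix.mulVec_sum]
      simp only [Matrix.mulVec_smul]
    rw [e v, e v', map_sum, sum_dotProduct]
    apply Finset.sum_eq_zero
    intro i _
    rw [dotProduct_sum]
    apply Finset.sum_eq_zero
    intro j _
    rw [map_smul, smul_dotProduct, dotProduct_smul, hcol]; simp
  have hle : (LinearMap.range (Matrix.mulVecLin A)).map (swapE n).toLinearMap ≤
      LinearMap.ker (Matrix.mulVecLin A.transpose) := by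
    rintro _ ⟨_, ⟨v, rfl⟩, rfl⟩
    rw [LinearMap.mem_ker]
    ext i
    have := hiso v (Pi.single i 1)
    rw [symp_eq, Matrix.mulVec_single_one, dotProduct_comm] at this
    exact this
  have heq := Submodule.eq_of_le_of_finrank_eq hle (by
    rw [LinearEquiv.finrank_map_eq]
    have : Module.finrank F (LinearMap.range (Matrix.mulVecLin A)) = n := hr
    omega)
  have hm : u ∈ LinearMap.ker (Matrix.mulVecLin A.transpose) := hu
  have hm' : u' ∈ LinearMap.ker (Matrix.mulVecLin A.transpose) := hu'
  rw [← heq] at hm hm'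
  obtain ⟨_, ⟨v, rfl⟩, rfl⟩ := hm
  obtain ⟨_, ⟨v', rfl⟩, rfl⟩ := hm'
  rw [symp_eq]
  have := hiso v v'
  rw [symp_eq] at this
  rw [← this]
  exact dot_swap _ _

/-- The possible products `B * A`. -/
noncomputable def Ms {n s : ℕ} (B : Matrix (Fin s) (Fin n ⊕ Fin n) F) :
    Finset (Matrix (Fin s) (Fin n) F) :=
  (fullRankIso n n).image fun A => B * A

lemma filter_card_submodule {V : Type*} [AddCommGroup V] [Module F V] [Fintype V]
    (p : Submodule F V) :
    (Finset.univ.filter fun y : V => y ∈ p).card = 2 ^ Module.finrank F p := by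
  rw [← natCard_eq, ← Fintype.card_subtype, ← Nat.card_eq_fintype_card]

/-- matrices all of whose columns lie in a subspace -/
lemma card_cols {s n : ℕ} (p : Submodule F (Fin s → F)) (X : Finset (Matrix (Fin s) (Fin n) F))
    (h : ∀ M ∈ X, ∀ j, M.col j ∈ p) : X.card ≤ 2 ^ (Module.finrank F p * n) := by
  have : X.card ≤ (Fintype.piFinset (fun _ : Fin n =>
      Finset.univ.filter fun y : Fin s → F => y ∈ p)).card := by
    apply Finset.card_le_card_of_injOn (fun M => M.col)
    · intro M hM
      simp only [Finset.mem_coe, Fintype.mem_piFinset, Finset.mem_filter, Finset.mem_univ, true_and]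
      intro j
      exact h M hM j
    · intro M _ M' _ hh
      ext i j
      exact congrFun (congrFun hh j) i
  rw [Fintype.card_piFinset] at this
  simpa [filter_card_submodule, pow_mul] using this

lemma count_lo {n s : ℕ} (B : Matrix (Fin s) (Fin n ⊕ Fin n) F) :
    (Ms B).card ≤ 2 ^ (B.rank * n) := by
  apply card_cols (LinearMap.range (Matrix.mulVecLin B))
  intro M hM j
  simp only [Ms, Finset.mem_image] at hM
  obtain ⟨A, _, rfl⟩ := hM
  exact ⟨A.col j, rfl⟩

lemma count_indep {V : Type*} [AddCommGroup V] [Module F V] [Fintype V] (p : Submodule F V) (k : ℕ)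
    (h : k ≤ Module.finrank F p) :
    2 ^ ((k - 1) * k) ≤ (Finset.univ.filter fun Y : Fin k → V =>
      LinearIndependent F Y ∧ ∀ i, Y i ∈ p).card := by
  have h1 := card_linearIndependent (K := F) (V := p) h
  have h2 : Nat.card {Y : Fin k → p // LinearIndependent F Y} ≤
      Nat.card {Y : Fin k → V // LinearIndependent F Y ∧ ∀ i, Y i ∈ p} := by
    apply Nat.card_le_card_of_injective (fun Y => ⟨fun i => (Y.1 i : V), by
      refine ⟨?_, fun i => (Y.1 i).2⟩
      exact Y.2.map' p.subtype p.ker_subtype⟩)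
    intro Y Y' hh
    ext i
    have := congrArg (fun z => z.1 i) hh
    exact this
  rw [h1] at h2
  rw [← Fintype.card_subtype, ← Nat.card_eq_fintype_card]
  refine le_trans ?_ h2
  rw [pow_mul]
  calc _ = ∏ _i : Fin k, 2 ^ (k - 1) := by simp
    _ ≤ _ := by
      apply Finset.prod_le_prod' 
      intro i _
      rw [ZMod.card]
      have hi := i.2
      have e1 : 2 ^ (i : ℕ) ≤ 2 ^ (Module.finrank F p - 1) :=
        Nat.pow_le_pow_right (by norm_num) (by omega)
      have e2 : 2 ^ (k - 1) ≤ 2 ^ (Module.finrank F p - 1) :=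
        Nat.pow_le_pow_right (by norm_num) (by omega)
      have e3 : 2 ^ (Module.finrank F p) = 2 * 2 ^ (Module.finrank F p - 1) := by
        rw [← pow_succ']; congr 1; omega
      omega

lemma count_hi {n a : ℕ} (B : Matrix (Fin (n + (a + a))) (Fin n ⊕ Fin n) F)
    (ha : 1 ≤ a) (h : n + a ≤ B.rank) :
    (Ms B).card * 2 ^ (a * a) ≤ 2 ^ (n * (n + (a + a)) + 3 * a) := by
  set V := Fin (n + (a + a)) → F with hV
  let t : Finset (Fin (a + a) → V) := Finset.univ.filter fun Y =>
    LinearIndependent F Y ∧ ∀ i j : Fin a, form B (Y (Fin.castAdd a i)) (Y (Fin.natAdd a j)) = 0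
  let r : Matrix (Fin (n + (a + a))) (Fin n) F → (Fin (a + a) → V) → Prop := fun M Y =>
    LinearIndependent F Y ∧ ∀ i, Y i ∈ LinearMap.ker (Matrix.mulVecLin M.transpose)
  have main : (Ms B).card * 2 ^ ((a + a - 1) * (a + a)) ≤ t.card * 2 ^ (n * n) := by
    apply Finset.card_mul_le_card_mul r
    · intro M hM
      simp only [Ms, Finset.mem_image] at hM
      obtain ⟨A, hA, rfl⟩ := hM
      have hk : a + a ≤ Module.finrank F (LinearMap.ker (Matrix.mulVecLin (B * A).transpose)) := by
        have h1 := LinearMap.finrank_range_add_finrank_ker (Matrix.mulVecLin (B * A).transpose)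
        have h2 := Submodule.finrank_le (LinearMap.range (Matrix.mulVecLin (B * A).transpose))
        simp only [Module.finrank_fintype_fun_eq_card, Fintype.card_fin] at h1 h2
        omega
      refine (count_indep _ _ hk).trans (Finset.card_le_card ?_)
      intro Y hY
      simp only [Finset.mem_filter, Finset.mem_univ, true_and] at hY
      simp only [Finset.bipartiteAbove, Finset.mem_filter, t, r, Finset.mem_univ, true_and]
      refine ⟨⟨hY.1, fun i j => ?_⟩, hY⟩
      rw [form_apply]
      apply lagr hA
      · have := hY.2 (Fin.castAdd a i)
        rw [LinearMap.mem_ker, Matrix.mulVecLin_apply, Matrix.transpose_mul] at this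
        rw [Matrix.mulVec_mulVec]; exact this
      · have := hY.2 (Fin.natAdd a j)
        rw [LinearMap.mem_ker, Matrix.mulVecLin_apply, Matrix.transpose_mul] at this
        rw [Matrix.mulVec_mulVec]; exact this
    · intro Y hY
      simp only [t, Finset.mem_filter, Finset.mem_univ, true_and] at hY
      have hrk : Module.finrank F (LinearMap.ker (Matrix.mulVecLin (Matrix.of Y))) = n := by
        have h1 := LinearMap.finrank_range_add_finrank_ker (Matrix.mulVecLin (Matrix.of Y))
        have h2 : Module.finrank F (LinearMap.range (Matrix.mulVecLin (Matrix.of Y))) = a + a := by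
          have := LinearIndependent.rank_matrix (M := Matrix.of Y) hY.1
          simpa [Matrix.rank] using this
        simp only [Module.finrank_fintype_fun_eq_card, Fintype.card_fin] at h1 h2
        omega
      have := card_cols (LinearMap.ker (Matrix.mulVecLin (Matrix.of Y)))
        ((Ms B).bipartiteBelow r Y) (by
          intro M hM j
          simp only [Finset.bipartiteBelow, Finset.mem_filter, r] at hM
          rw [LinearMap.mem_ker]
          ext i
          have := congrFun (LinearMap.mem_ker.1 (hM.2.2 i)) j
          rw [Matrix.mulVecLin_apply] at this ⊢
          simp only [Matrix.mulVec] at this ⊢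
          rw [dotProduct_comm] at this
          exact this)
      rwa [hrk] at this
  have ht : t.card * 2 ^ (a * a) ≤ 2 ^ ((n + (a + a)) * (a + a)) * 2 ^ a := by
    have h1 := pair_count (form B) a (form_rank B a h)
    have hcV : Fintype.card (Fin (n + (a + a)) → F) = 2 ^ (n + (a + a)) := by
      simp [ZMod.card]
    rw [hcV, ← pow_mul] at h1
    refine le_trans (Nat.mul_le_mul_right _ ?_) h1
    apply Finset.card_le_card_of_injOn
      (fun Y => (fun i => Y (Fin.castAdd a i), fun j => Y (Fin.natAdd a j)))
    · intro Y hY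
      simp only [t, Finset.coe_filter, Finset.mem_univ, true_and, Set.mem_ofPred_eq] at hY ⊢
      exact hY.2
    · intro Y _ Y' _ hh
      simp only [Prod.mk.injEq] at hh
      funext i
      refine Fin.addCases (fun i => congrFun hh.1 i) (fun i => congrFun hh.2 i) i
  have e1 : (a + a - 1) * (a + a) + 2 * a = 4 * (a * a) := by
    obtain ⟨b, rfl⟩ := Nat.exists_eq_add_of_le ha
    have : 1 + b + (1 + b) - 1 = 1 + b + b := by omega
    rw [this]; ring
  apply Nat.le_of_mul_le_mul_right (c := 2 ^ (4 * (a * a))) _ (by positivity)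
  calc (Ms B).card * 2 ^ (a * a) * 2 ^ (4 * (a * a))
      = ((Ms B).card * 2 ^ ((a + a - 1) * (a + a))) * 2 ^ (a * a) * 2 ^ (2 * a) := by
        rw [← e1, pow_add]; ring
    _ ≤ (t.card * 2 ^ (n * n)) * 2 ^ (a * a) * 2 ^ (2 * a) := by gcongr
    _ = (t.card * 2 ^ (a * a)) * 2 ^ (n * n) * 2 ^ (2 * a) := by ring
    _ ≤ (2 ^ ((n + (a + a)) * (a + a)) * 2 ^ a) * 2 ^ (n * n) * 2 ^ (2 * a) := by gcongr
    _ = _ := by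
      rw [← pow_add, ← pow_add, ← pow_add, ← pow_add]
      congr 1; ring

lemma count_all {n a : ℕ} (B : Matrix (Fin (n + (a + a))) (Fin n ⊕ Fin n) F)
    (ha : 1 ≤ a) (han : a ≤ n) :
    (Ms B).card * 2 ^ (a * a) ≤ 2 ^ (n * (n + (a + a)) + 3 * a) := by
  rcases le_total (n + a) B.rank with h | h
  · exact count_hi B ha h
  · calc _ ≤ 2 ^ (B.rank * n) * 2 ^ (a * a) := by gcongr; exact count_lo B
      _ = 2 ^ (B.rank * n + a * a) := by rw [pow_add]
      _ ≤ _ := by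
        apply Nat.pow_le_pow_right (by norm_num)
        nlinarith

end symplectic

section counting

/-- Number of qubits on which `b` is nontrivial. -/
noncomputable def pwt {n : ℕ} (b : Fin n ⊕ Fin n → F) : ℕ :=
  (Finset.univ.filter fun j : Fin n => ¬ (b (Sum.inl j) = 0 ∧ b (Sum.inr j) = 0)).card

lemma sum_prod_pairs {n : ℕ} (f : Fin n → F → F → ℝ) :
    ∑ e : Fin n ⊕ Fin n → F, ∏ j, f j (e (Sum.inl j)) (e (Sum.inr j)) =
      ∏ j, ∑ z : F × F, f j z.1 z.2 := by
  rw [Fintype.prod_sum]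
  refine Fintype.sum_equiv ((Equiv.sumArrowEquivProdArrow (Fin n) (Fin n) F).trans
    (Equiv.arrowProdEquivProdArrow (Fin n) (fun _ => F) (fun _ => F)).symm) _ _ ?_
  intro e
  rfl

lemma sum_FF (g : F × F → ℝ) : ∑ z : F × F, g z = g (0,0) + g (0,1) + g (1,0) + g (1,1) := by
  rw [Fintype.sum_prod_type]
  have h : ∀ h : F → ℝ, ∑ x : F, h x = h 0 + h 1 := fun h => Fin.sum_univ_two h
  simp only [h]
  ring

lemma pow_pwt {n : ℕ} (x : ℝ) (b : Fin n ⊕ Fin n → F) :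
    x ^ pwt b = ∏ j, if b (Sum.inl j) = 0 ∧ b (Sum.inr j) = 0 then 1 else x := by
  rw [Finset.prod_ite]
  simp [pwt]

lemma sum_pow_pwt {n : ℕ} (x : ℝ) : ∑ b : Fin n ⊕ Fin n → F, x ^ pwt b = (1 + 3 * x) ^ n := by
  simp only [pow_pwt]
  rw [sum_prod_pairs (fun _ u v => if u = 0 ∧ v = 0 then 1 else x)]
  simp only [sum_FF]
  simp
  ring

/-- Low-weight vectors. -/
noncomputable def Lset (n : ℕ) (ε : ℝ) : Finset (Fin n ⊕ Fin n → F) :=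
  Finset.univ.filter fun b => (pwt b : ℝ) ≤ ε * n

lemma Lset_bound (η : ℝ) (hη : 0 < η) : ∃ ε : ℝ, 0 < ε ∧ ∀ n : ℕ,
    ((Lset n ε).card : ℝ) ≤ Real.exp (η * n) := by
  -- choose x = exp (-y)
  obtain ⟨y, hy0, hy⟩ : ∃ y : ℝ, 0 < y ∧ 3 * Real.exp (-y) ≤ η / 2 := by
    have h1 : Filter.Tendsto (fun y : ℝ => 3 * Real.exp (-y)) Filter.atTop (nhds (3 * 0)) :=
      (Real.tendsto_exp_neg_atTop_nhds_zero).const_mul 3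
    have h2 : ∀ᶠ y in Filter.atTop, 3 * Real.exp (-y) ≤ η / 2 :=
      h1.eventually_le_const (by simpa using hη)
    obtain ⟨y, h3, h4⟩ := (h2.and (Filter.eventually_gt_atTop 0)).exists
    exact ⟨y, h4, h3⟩
  refine ⟨η / (2 * y), by positivity, fun n => ?_⟩
  have h1 : ((Lset n (η / (2 * y))).card : ℝ) * Real.exp (-(η / 2 * n)) ≤
      ∑ b : Fin n ⊕ Fin n → F, (Real.exp (-y)) ^ pwt b := by
    calc _ = ∑ b ∈ Lset n (η / (2 * y)), Real.exp (-(η / 2 * n)) := by simp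
      _ ≤ ∑ b ∈ Lset n (η / (2 * y)), (Real.exp (-y)) ^ pwt b := by
        apply Finset.sum_le_sum
        intro b hb
        simp only [Lset, Finset.mem_filter, Finset.mem_univ, true_and] at hb
        rw [← Real.exp_nat_mul, Real.exp_le_exp]
        have : (pwt b : ℝ) * y ≤ η / (2 * y) * n * y := by gcongr
        have e : η / (2 * y) * n * y = η / 2 * n := by field_simp
        linarith
      _ ≤ _ := Finset.sum_le_sum_of_subset_of_nonneg (Finset.subset_univ _)
        (fun _ _ _ => by positivity)
  rw [sum_pow_pwt] at h1
  have h2 : (1 + 3 * Real.exp (-y)) ^ n ≤ Real.exp (η / 2 * n) := by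
    calc _ ≤ (Real.exp (η / 2)) ^ n := by
          gcongr
          linarith [Real.add_one_le_exp (η / 2)]
      _ = _ := by rw [← Real.exp_nat_mul]; ring_nf
  have h3 := h1.trans h2
  rw [Real.exp_neg, ← div_eq_mul_inv, div_le_iff₀ (Real.exp_pos _), ← Real.exp_add] at h3
  refine h3.trans (le_of_eq ?_)
  ring_nf

lemma card_fiber {m n s : ℕ} (f : Fin s → Fin m) (hf : Function.Injective f)
    (X : Finset (Matrix (Fin s) (Fin n) F)) :
    (Finset.univ.filter fun M : Matrix (Fin m) (Fin n) F => M.submatrix f id ∈ X).card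
      ≤ X.card * 2 ^ (n * (m - s)) := by
  let R := {i : Fin m // i ∉ Set.range f}
  have hR : Fintype.card R = m - s := by
    have : Fintype.card R = Fintype.card (Fin m) - Fintype.card {i // i ∈ Set.range f} :=
      Fintype.card_subtype_compl _
    rw [this, Fintype.card_fin]
    congr 1
    have := Set.card_range_of_injective hf
    rw [Fintype.card_fin] at this
    exact this
  have h1 : (Finset.univ.filter fun M : Matrix (Fin m) (Fin n) F => M.submatrix f id ∈ X).card ≤
      (X ×ˢ (Finset.univ : Finset (R → Fin n → F))).card := by
    apply Finset.card_le_card_of_injOn (fun M => (M.submatrix f id, fun i j => M i.1 j))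
    · intro M hM
      simp only [Finset.coe_filter, Finset.mem_univ, true_and, Set.mem_ofPred_eq] at hM
      simp only [Finset.coe_product, Finset.coe_univ, Set.mem_prod, Finset.mem_coe, Set.mem_univ,
        and_true]
      exact hM
    · intro M _ M' _ hh
      simp only [Prod.mk.injEq] at hh
      ext i j
      by_cases hi : i ∈ Set.range f
      · obtain ⟨k, rfl⟩ := hi
        exact congrFun (congrFun hh.1 k) j
      · exact congrFun (congrFun hh.2 ⟨i, hi⟩) j
  refine h1.trans (le_of_eq ?_)
  rw [Finset.card_product, Finset.card_univ]
  congr 1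
  rw [Fintype.card_fun, Fintype.card_fun, hR, ZMod.card, Fintype.card_fin, ← pow_mul]

/-- The distinguishing test. -/
noncomputable def Tset (m n a : ℕ) (ε : ℝ) : Finset (Matrix (Fin m) (Fin n) F) :=
  Finset.univ.filter fun M => ∃ f : Fin (n + (a + a)) → Fin m, Function.Injective f ∧
    ∃ B : Matrix (Fin (n + (a + a))) (Fin n ⊕ Fin n) F,
      (∀ i, B.row i ∈ Lset n ε) ∧ M.submatrix f id ∈ Ms B

lemma Tset_card {m n a : ℕ} (ε : ℝ) (ha : 1 ≤ a) (han : a ≤ n) :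
    (Tset m n a ε).card * 2 ^ (a * a) ≤
      m ^ (n + (a + a)) * (Lset n ε).card ^ (n + (a + a)) * 2 ^ (m * n + 3 * a) := by
  set s := n + (a + a) with hs
  let fs : Finset (Fin s → Fin m) := Finset.univ.filter fun f => Function.Injective f
  let Bs : Finset (Matrix (Fin s) (Fin n ⊕ Fin n) F) :=
    Finset.univ.filter fun B => ∀ i, B.row i ∈ Lset n ε
  have hsub : Tset m n a ε ⊆ (fs ×ˢ Bs).biUnion fun q =>
      Finset.univ.filter fun M : Matrix (Fin m) (Fin n) F => M.submatrix q.1 id ∈ Ms q.2 := by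
    intro M hM
    simp only [Tset, Finset.mem_filter, Finset.mem_univ, true_and] at hM
    obtain ⟨f, hf, B, hB, hM⟩ := hM
    simp only [Finset.mem_biUnion, Finset.mem_product, Finset.mem_filter, Finset.mem_univ,
      true_and]
    exact ⟨(f, B), ⟨by simpa [fs] using hf, Finset.mem_filter.2 ⟨Finset.mem_univ _, hB⟩⟩, hM⟩
  have h1 := (Finset.card_le_card hsub).trans Finset.card_biUnion_le
  have h2 : ∀ q ∈ fs ×ˢ Bs, (Finset.univ.filter fun M : Matrix (Fin m) (Fin n) F =>
      M.submatrix q.1 id ∈ Ms q.2).card * 2 ^ (a * a) ≤ 2 ^ (m * n + 3 * a) := by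
    rintro ⟨f, B⟩ hq
    simp only [Finset.mem_product, fs, Finset.mem_filter, Finset.mem_univ, true_and] at hq
    have hsm : s ≤ m := by simpa using Fintype.card_le_of_injective f hq.1
    calc _ ≤ (Ms B).card * 2 ^ (n * (m - s)) * 2 ^ (a * a) := by
          gcongr; exact card_fiber f hq.1 _
      _ = ((Ms B).card * 2 ^ (a * a)) * 2 ^ (n * (m - s)) := by ring
      _ ≤ 2 ^ (n * s + 3 * a) * 2 ^ (n * (m - s)) := by
        gcongr
        exact count_all B ha han
      _ = _ := by
        rw [← pow_add]; congr 1
        obtain ⟨d, rfl⟩ := Nat.exists_eq_add_of_le hsm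
        rw [Nat.add_sub_cancel_left]; ring
  calc _ ≤ (∑ q ∈ fs ×ˢ Bs, (Finset.univ.filter fun M : Matrix (Fin m) (Fin n) F =>
      M.submatrix q.1 id ∈ Ms q.2).card) * 2 ^ (a * a) := by gcongr
    _ ≤ ∑ q ∈ fs ×ˢ Bs, 2 ^ (m * n + 3 * a) := by
      rw [Finset.sum_mul]; exact Finset.sum_le_sum h2
    _ = fs.card * Bs.card * 2 ^ (m * n + 3 * a) := by
      rw [Finset.sum_const, Finset.card_product, smul_eq_mul]
    _ ≤ _ := by
      gcongr
      · refine (Finset.card_filter_le _ _).trans (le_of_eq ?_)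
        simp
      · have : Bs.card ≤ (Fintype.piFinset fun _ : Fin s => Lset n ε).card := by
          apply Finset.card_le_card_of_injOn (fun B => B.row)
          · intro B hB
            simp only [Finset.mem_coe, Fintype.mem_piFinset]
            exact (Finset.mem_filter.1 hB).2
          · intro B _ B' _ hh
            exact hh
        rw [Fintype.card_piFinset] at this; simpa using this

end counting

section expectation

/-- sign character -/
noncomputable def chi (x : F) : ℝ := if x = 0 then 1 else -1

lemma chi_add (x y : F) : chi (x + y) = chi x * chi y := by
  have h01 : ∀ x : F, x = 0 ∨ x = 1 := by decide
  have h11 : (1 : F) + 1 = 0 := by decide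
  rcases h01 x with rfl | rfl <;> rcases h01 y with rfl | rfl <;> simp [chi, h11]

lemma chi_sum {ι : Type*} (s : Finset ι) (f : ι → F) : chi (∑ i ∈ s, f i) = ∏ i ∈ s, chi (f i) := by
  induction s using Finset.induction_on with
  | empty => simp [chi]
  | insert i s hi ih => rw [Finset.sum_insert hi, Finset.prod_insert hi, chi_add, ih]

lemma dep_chi {n : ℕ} (p : ℝ) (b : Fin n ⊕ Fin n → F) :
    ∑ e, depDensity p n e * chi (b ⬝ᵥ e) = (1 - 4 * p / 3) ^ pwt b := by
  have h : ∀ e : Fin n ⊕ Fin n → F, depDensity p n e * chi (b ⬝ᵥ e) =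
      ∏ j, (fun (j : Fin n) (x z : F) => pairProb p x z *
        chi (b (Sum.inl j) * x + b (Sum.inr j) * z)) j (e (Sum.inl j)) (e (Sum.inr j)) := by
    intro e
    simp only [depDensity, dotProduct, Fintype.sum_sum_type, ← Finset.sum_add_distrib, chi_sum,
      ← Finset.prod_mul_distrib]
  rw [Finset.sum_congr rfl (fun e _ => h e),
    sum_prod_pairs (fun (j : Fin n) (x z : F) => pairProb p x z *
        chi (b (Sum.inl j) * x + b (Sum.inr j) * z)), pow_pwt]
  apply Finset.prod_congr rfl
  intro j _
  rw [sum_FF]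
  have h01 : ∀ x : F, x = 0 ∨ x = 1 := by decide
  have h11 : (1 : F) + 1 = 0 := by decide
  rcases h01 (b (Sum.inl j)) with h1 | h1 <;> rcases h01 (b (Sum.inr j)) with h2 | h2 <;>
    rw [h1, h2] <;> simp [pairProb, chi, h11] <;> ring

lemma dep_sum {n : ℕ} (p : ℝ) : ∑ e, depDensity p n e = 1 := by
  have := dep_chi (n := n) p 0
  simpa [chi, pwt] using this

lemma expect_eq {m n : ℕ} (p : ℝ) (B : Matrix (Fin m) (Fin n ⊕ Fin n) F) :
    ∑ e : (Fin n ⊕ Fin n) → ZMod 2, depDensity p n e * (hWt (B.mulVec e) : ℝ) =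
      ∑ i, (1 - (1 - 4 * p / 3) ^ pwt (B.row i)) / 2 := by
  have h : ∀ e : Fin n ⊕ Fin n → F, (hWt (B.mulVec e) : ℝ) = ∑ i, (1 - chi (B.row i ⬝ᵥ e)) / 2 := by
    intro e
    have h0 : ∀ i, (1 - chi (B.row i ⬝ᵥ e)) / 2 = if B.mulVec e i ≠ 0 then 1 else 0 := by
      intro i
      change (1 - chi (B.mulVec e i)) / 2 = _
      by_cases hx : B.mulVec e i = 0
      · simp [chi, hx]
      · simp [chi, hx]
    simp only [h0]
    rw [Finset.sum_boole]
    rw [hWt]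
  simp only [h, Finset.mul_sum]
  rw [Finset.sum_comm]
  apply Finset.sum_congr rfl
  intro i _
  rw [← dep_chi p (B.row i)]
  conv_rhs => rw [← dep_sum (n := n) p]
  rw [← Finset.sum_sub_distrib, Finset.sum_div]
  apply Finset.sum_congr rfl
  intro e _
  ring

/-- If few rows have low weight, the expectation is large. -/
lemma expect_lower {m n : ℕ} (p ε τ : ℝ) (hp0 : 0 < p) (hp : p ≤ 3 / 4)
    (hτ : Real.exp (-(4 / 3 * ε * (n * p))) ≤ τ)
    (B : Matrix (Fin m) (Fin n ⊕ Fin n) F) :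
    (((m : ℝ) - (Finset.univ.filter fun i => B.row i ∈ Lset n ε).card) - τ * m) / 2 ≤
      ∑ e : (Fin n ⊕ Fin n) → ZMod 2, depDensity p n e * (hWt (B.mulVec e) : ℝ) := by
  have hτ0 : 0 ≤ τ := (Real.exp_pos _).le.trans hτ
  have hq0 : 0 ≤ 1 - 4 * p / 3 := by linarith
  have hq1 : 1 - 4 * p / 3 ≤ 1 := by linarith
  rw [expect_eq]
  have h : ∀ i, (1 - (if B.row i ∈ Lset n ε then 1 else 0) - τ) / 2 ≤
      (1 - (1 - 4 * p / 3) ^ pwt (B.row i)) / 2 := by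
    intro i
    split_ifs with hi
    · have := pow_le_one₀ (n := pwt (B.row i)) hq0 hq1
      linarith
    · simp only [Lset, Finset.mem_filter, Finset.mem_univ, true_and, not_le] at hi
      have h1 : (1 - 4 * p / 3) ^ pwt (B.row i) ≤ (Real.exp (-(4 * p / 3))) ^ pwt (B.row i) := by
        gcongr
        linarith [Real.add_one_le_exp (-(4 * p / 3))]
      have h2 : (Real.exp (-(4 * p / 3))) ^ pwt (B.row i) ≤ Real.exp (-(4 / 3 * ε * (n * p))) := by
        rw [← Real.exp_nat_mul, Real.exp_le_exp]
        nlinarith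
      linarith
  refine le_trans (le_of_eq ?_) (Finset.sum_le_sum fun i _ => h i)
  rw [← Finset.sum_div, Finset.sum_sub_distrib, Finset.sum_sub_distrib, Finset.sum_boole]
  simp
  ring

end expectation

section final

lemma iso_card_pos (n : ℕ) : 0 < (fullRankIso n n).card := by
  rw [Finset.card_pos]
  let A : Matrix (Fin n ⊕ Fin n) (Fin n) F := Matrix.of (Sum.elim (fun i j => if i = j then 1 else 0)
    (fun _ _ => 0))
  refine ⟨A, ?_⟩
  simp only [fullRankIso, Finset.mem_filter, Finset.mem_univ, true_and]
  constructor
  · have hinj : Function.Injective (Matrix.mulVecLin A) := by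
      intro v v' h
      funext i
      have := congrFun h (Sum.inl i)
      simpa [A, Matrix.mulVec, dotProduct] using this
    have := LinearMap.finrank_range_of_inj hinj
    simpa [Matrix.rank] using this
  · intro i j
    simp [symp, A]

lemma low_mem_T {m n a : ℕ} (ε : ℝ) (B : Matrix (Fin m) (Fin n ⊕ Fin n) F)
    (h : n + (a + a) ≤ (Finset.univ.filter fun i => B.row i ∈ Lset n ε).card)
    {A : Matrix (Fin n ⊕ Fin n) (Fin n) F} (hA : A ∈ fullRankIso n n) :
    B * A ∈ Tset m n a ε := by
  set S := Finset.univ.filter fun i => B.row i ∈ Lset n ε with hS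
  let f : Fin (n + (a + a)) → Fin m := fun i => (S.equivFin.symm (Fin.castLE h i)).1
  have hf : Function.Injective f := by
    intro i j hij
    have h1 := S.equivFin.symm.injective (Subtype.ext hij)
    exact Fin.castLE_injective h h1
  simp only [Tset, Finset.mem_filter, Finset.mem_univ, true_and]
  refine ⟨f, hf, B.submatrix f id, ?_, ?_⟩
  · intro i
    have := (S.equivFin.symm (Fin.castLE h i)).2
    exact (Finset.mem_filter.1 this).2
  · exact Finset.mem_image.2 ⟨A, hA, rfl⟩

lemma tv_step {m n : ℕ} (μ : Matrix (Fin m) (Fin n ⊕ Fin n) (ZMod 2) → ℝ)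
    (hμ0 : ∀ B, 0 ≤ μ B) (T : Finset (Matrix (Fin m) (Fin n) (ZMod 2)))
    (Bad : Finset (Matrix (Fin m) (Fin n ⊕ Fin n) (ZMod 2)))
    (h : ∀ B ∈ Bad, ∀ A ∈ fullRankIso n n, B * A ∈ T) :
    ∑ B ∈ Bad, μ B ≤ (T.card : ℝ) / 2 ^ (m * n) + 
      ∑ M : Matrix (Fin m) (Fin n) (ZMod 2),
        |(∑ B : Matrix (Fin m) (Fin n ⊕ Fin n) (ZMod 2), μ B *
              ((((fullRankIso n n).filter fun A => B * A = M).card : ℝ) /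
                ((fullRankIso n n).card : ℝ)))
          - 1 / (Fintype.card (Matrix (Fin m) (Fin n) (ZMod 2)) : ℝ)| := by
  have hN : (0 : ℝ) < (fullRankIso n n).card := by exact_mod_cast iso_card_pos n
  have hcard : (Fintype.card (Matrix (Fin m) (Fin n) (ZMod 2)) : ℝ) = 2 ^ (m * n) := by
    rw [← Nat.card_eq_fintype_card, natCard_eq, Module.finrank_matrix]
    simp
  set law : Matrix (Fin m) (Fin n) (ZMod 2) → ℝ := fun M =>
    ∑ B : Matrix (Fin m) (Fin n ⊕ Fin n) (ZMod 2), μ B *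
              ((((fullRankIso n n).filter fun A => B * A = M).card : ℝ) /
                ((fullRankIso n n).card : ℝ)) with hlaw
  have h1 : ∑ B ∈ Bad, μ B ≤ ∑ M ∈ T, law M := by
    simp only [hlaw]
    rw [Finset.sum_comm]
    have h2 : ∀ B ∈ Bad, μ B = ∑ M ∈ T, μ B *
              ((((fullRankIso n n).filter fun A => B * A = M).card : ℝ) /
                ((fullRankIso n n).card : ℝ)) := by
      intro B hB
      rw [← Finset.mul_sum, ← Finset.sum_div]
      have h3 := Finset.card_eq_sum_card_fiberwise (f := fun A => B * A) (s := fullRankIso n n)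
        (t := T) (fun A hA => h B hB A hA)
      rw [← Nat.cast_sum, ← h3, div_self hN.ne', mul_one]
    rw [Finset.sum_congr rfl h2]
    apply Finset.sum_le_sum_of_subset_of_nonneg (Finset.subset_univ _)
    intro B _ _
    apply Finset.sum_nonneg
    intro M _
    have := hμ0 B
    positivity
  refine h1.trans ?_
  calc ∑ M ∈ T, law M ≤ ∑ M ∈ T, (1 / 2 ^ (m * n) + |law M - 1 / 2 ^ (m * n)|) := by
        apply Finset.sum_le_sum
        intro M _
        linarith [le_abs_self (law M - 1 / 2 ^ (m * n))]
    _ = (T.card : ℝ) / 2 ^ (m * n) + ∑ M ∈ T, |law M - 1 / 2 ^ (m * n)| := by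
        rw [Finset.sum_add_distrib]; simp [div_eq_mul_inv]
    _ ≤ (T.card : ℝ) / 2 ^ (m * n) + ∑ M, |law M - 1 / 2 ^ (m * n)| := by
        gcongr
        exact Finset.subset_univ _
    _ = _ := by rw [hcard]

/-- numerical bound for the test -/
lemma T_small {m n a : ℕ} (ε η α K : ℝ) (hα : 0 < α) (hα1 : α ≤ 1 / 4)
    (hη : η = α ^ 2 / 32)
    (ha : a = ⌊α * n⌋₊) (hL : ((Lset n ε).card : ℝ) ≤ Real.exp (η * n))
    (hm0 : 0 < m) (hm : (m : ℝ) ≤ (n : ℝ) ^ K) (hK : 1 ≤ K) (hn : 2 ≤ α * n)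
    (hlog : 2 * K * Real.log n + 4 ≤ α ^ 2 / 16 * n) :
    ((Tset m n a ε).card : ℝ) / 2 ^ (m * n) ≤ Real.exp (-n) := by
  have hn0 : (0 : ℝ) < n := by
    by_contra hh
    push Not at hh
    nlinarith
  have hn1 : (1 : ℝ) ≤ n := by
    have : 0 < n := by exact_mod_cast hn0
    exact_mod_cast this
  have hfl : (a : ℝ) ≤ α * n := by rw [ha]; exact Nat.floor_le (by positivity)
  have hfl2 : α * n / 2 ≤ (a : ℝ) := by
    have := Nat.lt_floor_add_one (α * n)
    rw [← ha] at this
    linarith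
  have ha1 : 1 ≤ a := by
    have : (1 : ℝ) ≤ a := by linarith
    exact_mod_cast this
  have han : a ≤ n := by
    have : (a : ℝ) ≤ n := by nlinarith
    exact_mod_cast this
  have hcard := Tset_card (m := m) ε ha1 han
  have hcard' : ((Tset m n a ε).card : ℝ) * 2 ^ (a * a) ≤
      (m : ℝ) ^ (n + (a + a)) * ((Lset n ε).card : ℝ) ^ (n + (a + a)) * 2 ^ (m * n + 3 * a) := by
    exact_mod_cast hcard
  have hs : ((n + (a + a) : ℕ) : ℝ) ≤ 2 * n := by
    push_cast; nlinarith
  have hlogn : 0 ≤ Real.log n := Real.log_nonneg hn1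
  have hmb : (m : ℝ) ^ (n + (a + a)) ≤ Real.exp (2 * K * Real.log n * n) := by
    calc (m : ℝ) ^ (n + (a + a)) ≤ ((n : ℝ) ^ K) ^ (n + (a + a)) := by gcongr
      _ = Real.exp ((n + (a + a) : ℕ) * (Real.log n * K)) := by
        rw [Real.rpow_def_of_pos hn0, ← Real.exp_nat_mul]
      _ ≤ _ := by
        rw [Real.exp_le_exp]
        have : ((n + (a + a) : ℕ) : ℝ) * (Real.log n * K) ≤ 2 * n * (Real.log n * K) := by gcongr
        linarith
  have hη0 : 0 ≤ η := by rw [hη]; positivity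
  have hLb : ((Lset n ε).card : ℝ) ^ (n + (a + a)) ≤ Real.exp (2 * η * n * n) := by
    calc _ ≤ (Real.exp (η * n)) ^ (n + (a + a)) := by gcongr
      _ = Real.exp ((n + (a + a) : ℕ) * (η * n)) := by rw [← Real.exp_nat_mul]
      _ ≤ _ := by
        rw [Real.exp_le_exp]
        have : ((n + (a + a) : ℕ) : ℝ) * (η * n) ≤ 2 * n * (η * n) := by gcongr
        linarith
  have h2a : (2 : ℝ) ^ (3 * a) ≤ Real.exp (3 * n) := by
    have h2 : (2 : ℝ) ≤ Real.exp 1 := by linarith [Real.add_one_le_exp (1 : ℝ)]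
    calc (2 : ℝ) ^ (3 * a) ≤ (Real.exp 1) ^ (3 * a) := by gcongr
      _ = Real.exp ((3 * a : ℕ) * 1) := by rw [← Real.exp_nat_mul]
      _ ≤ _ := by
        rw [Real.exp_le_exp]; push_cast
        have : (a : ℝ) ≤ n := by exact_mod_cast han
        linarith
  have h2aa : Real.exp (α ^ 2 / 8 * n * n) ≤ (2 : ℝ) ^ (a * a) := by
    have h2 : Real.exp (1 / 2) ≤ 2 := by
      have h3 := Real.exp_one_lt_d9
      have h4 : Real.exp (1 / 2) * Real.exp (1 / 2) = Real.exp 1 := by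
        rw [← Real.exp_add]; norm_num
      nlinarith [Real.exp_pos (1 / 2)]
    calc _ ≤ Real.exp ((a * a : ℕ) * (1 / 2)) := by
          rw [Real.exp_le_exp]; push_cast
          have : (α * n / 2) * (α * n / 2) ≤ (a : ℝ) * a := by gcongr
          nlinarith
      _ = (Real.exp (1 / 2)) ^ (a * a) := by rw [← Real.exp_nat_mul]
      _ ≤ _ := by gcongr
  rw [div_le_iff₀ (by positivity)]
  have hfin : Real.exp (2 * K * Real.log n * n) * Real.exp (2 * η * n * n) * Real.exp (3 * n) ≤
      Real.exp (-n) * Real.exp (α ^ 2 / 8 * n * n) := by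
    rw [← Real.exp_add, ← Real.exp_add, ← Real.exp_add, Real.exp_le_exp, hη]
    nlinarith
  apply le_of_mul_le_mul_right _ (show (0 : ℝ) < 2 ^ (a * a) by positivity)
  calc _ ≤ (m : ℝ) ^ (n + (a + a)) * ((Lset n ε).card : ℝ) ^ (n + (a + a)) *
        2 ^ (m * n + 3 * a) := hcard'
    _ = (m : ℝ) ^ (n + (a + a)) * ((Lset n ε).card : ℝ) ^ (n + (a + a)) * 2 ^ (3 * a) *
        2 ^ (m * n) := by rw [pow_add]; ring
    _ ≤ Real.exp (2 * K * Real.log n * n) * Real.exp (2 * η * n * n) * Real.exp (3 * n) *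
        2 ^ (m * n) := by gcongr
    _ ≤ Real.exp (-n) * Real.exp (α ^ 2 / 8 * n * n) * 2 ^ (m * n) := by gcongr
    _ ≤ Real.exp (-n) * 2 ^ (a * a) * 2 ^ (m * n) := by gcongr
    _ = _ := by ring

end final

end Stmt4Aux

/-- If `B_n` is a random matrix in `F₂^{m_n×2n}`, independent of the uniformly random
full-rank isotropic `A_n ∈ F₂^{2n×n}` (with law given by the density `μ n`), and the
total variation distance between the law of `B_n·A_n` and the uniform distribution on
`F₂^{m_n×n}` is negligible, then the probability that
`E_{e ∼ D_{p_n}^{⊗n}}[|B_n·e|] < ((1 - n/m_n - δ)/2)·m_n` is negligible. -/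
theorem stmt4 (c K δ : ℝ) (hc : 1 < c) (hK : 1 ≤ K) (hδ : 0 < δ)
    (m : ℕ → ℕ) (hmpos : ∀ n, 0 < m n)
    (hm : ∀ n : ℕ, 2 ≤ n → c * n ≤ (m n : ℝ) ∧ (m n : ℝ) ≤ (n : ℝ) ^ K)
    (p : ℕ → ℝ) (hp : ∀ n, 0 < p n ∧ p n ≤ 3 / 4)
    (hnp : Filter.Tendsto (fun n : ℕ => (n : ℝ) * p n) Filter.atTop Filter.atTop)
    (μ : (n : ℕ) → Matrix (Fin (m n)) (Fin n ⊕ Fin n) (ZMod 2) → ℝ)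
    (hμ0 : ∀ n B, 0 ≤ μ n B) (hμ1 : ∀ n, ∑ B, μ n B = 1)
    (hTV : Negligible fun n =>
      (1 / 2) * ∑ M : Matrix (Fin (m n)) (Fin n) (ZMod 2),
        |(∑ B : Matrix (Fin (m n)) (Fin n ⊕ Fin n) (ZMod 2), μ n B *
              ((((fullRankIso n n).filter fun A => B * A = M).card : ℝ) /
                ((fullRankIso n n).card : ℝ)))
          - 1 / (Fintype.card (Matrix (Fin (m n)) (Fin n) (ZMod 2)) : ℝ)|) :
    Negligible fun n =>
      ∑ B ∈ Finset.univ.filter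
          (fun B : Matrix (Fin (m n)) (Fin n ⊕ Fin n) (ZMod 2) =>
            (∑ e : (Fin n ⊕ Fin n) → ZMod 2,
                depDensity (p n) n e * (hWt (B.mulVec e) : ℝ))
              < ((1 - (n : ℝ) / (m n : ℝ) - δ) / 2) * (m n : ℝ)),
        μ n B := by
  classical
  intro k
  set α : ℝ := min δ 1 / 8 with hα
  have hα0 : 0 < α := by positivity
  have hα1 : α ≤ 1 / 4 := by rw [hα]; linarith [min_le_right δ 1]
  have hαδ : α ≤ δ / 8 := by rw [hα]; linarith [min_le_left δ 1]
  obtain ⟨ε, hε0, hL⟩ := Stmt4Aux.Lset_bound (α ^ 2 / 32) (by positivity)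
  have ev1 : ∀ᶠ n : ℕ in Filter.atTop, Real.exp (-(4 / 3 * ε * (n * p n))) ≤ δ / 4 := by
    have h1 : Filter.Tendsto (fun n : ℕ => 4 / 3 * ε * (n * p n)) Filter.atTop Filter.atTop :=
      hnp.const_mul_atTop (by positivity)
    have h2 := Real.tendsto_exp_neg_atTop_nhds_zero.comp h1
    exact h2.eventually_le_const (by positivity)
  have ev2 : ∀ᶠ n : ℕ in Filter.atTop, 2 ≤ α * n :=
    (tendsto_natCast_atTop_atTop.const_mul_atTop hα0).eventually_ge_atTop 2
  have ev3 : ∀ᶠ n : ℕ in Filter.atTop, 2 * K * Real.log n + 4 ≤ α ^ 2 / 16 * n := by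
    have h1 : ∀ᶠ x : ℝ in Filter.atTop, ‖Real.log x‖ ≤ (α ^ 2 / (64 * K)) * ‖x‖ :=
      Real.isLittleO_log_id_atTop.bound (by positivity)
    have h2 := tendsto_natCast_atTop_atTop (R := ℝ) |>.eventually h1
    have h3 : ∀ᶠ n : ℕ in Filter.atTop, 4 ≤ α ^ 2 / 32 * n :=
      (tendsto_natCast_atTop_atTop.const_mul_atTop (by positivity)).eventually_ge_atTop 4
    filter_upwards [h2, h3] with n h2 h3
    have h4 : Real.log n ≤ α ^ 2 / (64 * K) * n := by
      have := (le_abs_self _).trans h2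
      simpa using this
    have h5 : 2 * K * Real.log n ≤ 2 * K * (α ^ 2 / (64 * K) * n) := by gcongr
    have h6 : 2 * K * (α ^ 2 / (64 * K) * n) = α ^ 2 / 32 * n := by
      field_simp; ring
    linarith
  have ev4 : ∀ᶠ n : ℕ in Filter.atTop, Real.exp (-n) * (n : ℝ) ^ k ≤ 1 / 2 := by
    have h1 := (Real.tendsto_pow_mul_exp_neg_atTop_nhds_zero k).comp
      (tendsto_natCast_atTop_atTop (R := ℝ))
    have h2 := h1.eventually_le_const (show (0 : ℝ) < 1 / 2 by norm_num)
    filter_upwards [h2] with n hn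
    rw [mul_comm]; exact hn
  obtain ⟨N0, hN0⟩ := hTV (k + 1)
  obtain ⟨N1, hN1⟩ := Filter.eventually_atTop.1 (ev1.and (ev2.and (ev3.and ev4)))
  refine ⟨max (max N0 N1) 4, fun n hn => ?_⟩
  have hn0 : N0 ≤ n := by omega
  have hn4 : 4 ≤ n := by omega
  obtain ⟨h1, h2, h3, h4⟩ := hN1 n (by omega)
  have htv := hN0 n hn0
  obtain ⟨hmc, hmK⟩ := hm n (by omega)
  have hn4' : (4 : ℝ) ≤ n := by exact_mod_cast hn4
  have hnm : (n : ℝ) ≤ m n := by nlinarith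
  have hm0 : (0 : ℝ) < m n := by linarith
  have hT := Stmt4Aux.T_small (m := m n) (n := n) (a := ⌊α * n⌋₊) ε (α ^ 2 / 32) α K hα0 hα1 rfl
    rfl (hL n) (hmpos n) hmK hK h2 h3
  refine (Stmt4Aux.tv_step (μ n) (hμ0 n) (Stmt4Aux.Tset (m n) n ⌊α * n⌋₊ ε) _ ?_).trans ?_
  · intro B hB A hA
    apply Stmt4Aux.low_mem_T ε B _ hA
    have hB' := (Finset.mem_filter.1 hB).2
    have hlow := Stmt4Aux.expect_lower (p n) ε (δ / 4) (hp n).1 (hp n).2 h1 B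
    have h5 := lt_of_le_of_lt hlow hB'
    have hfl : (⌊α * n⌋₊ : ℝ) ≤ α * n := Nat.floor_le (by positivity)
    have h6 : (1 - (n : ℝ) / m n - δ) / 2 * m n = (m n - n - δ * m n) / 2 := by
      field_simp
    rw [h6] at h5
    have h7 : α * n ≤ δ / 8 * m n := by gcongr
    have h8 : ((n + (⌊α * n⌋₊ + ⌊α * n⌋₊) : ℕ) : ℝ) ≤
        ((Finset.univ.filter fun i => B.row i ∈ Stmt4Aux.Lset n ε).card : ℝ) := by
      push_cast
      nlinarith
    exact_mod_cast h8
  · have hpk : (0 : ℝ) < (n : ℝ) ^ k := by positivity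
    rw [le_div_iff₀ hpk, add_mul]
    have h9 : ((Stmt4Aux.Tset (m n) n ⌊α * n⌋₊ ε).card : ℝ) / 2 ^ (m n * n) * (n : ℝ) ^ k ≤ 1 / 2 :=
      (mul_le_mul_of_nonneg_right hT hpk.le).trans h4
    rw [le_div_iff₀ (by positivity), pow_succ] at htv
    set S := ∑ M : Matrix (Fin (m n)) (Fin n) (ZMod 2),
        |(∑ B : Matrix (Fin (m n)) (Fin n ⊕ Fin n) (ZMod 2), μ n B *
              ((((fullRankIso n n).filter fun A => B * A = M).card : ℝ) /
                ((fullRankIso n n).card : ℝ)))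
          - 1 / (Fintype.card (Matrix (Fin (m n)) (Fin n) (ZMod 2)) : ℝ)| with hS
    have hS0 : 0 ≤ S := Finset.sum_nonneg fun _ _ => abs_nonneg _
    have h10 : 0 ≤ S * (n : ℝ) ^ k := by positivity
    have h11 : S * (n : ℝ) ^ k * 4 ≤ S * (n : ℝ) ^ k * n := by gcongr
    have h12 : S * (n : ℝ) ^ k * n ≤ 2 := by
      calc _ = 2 * (1 / 2 * S * ((n : ℝ) ^ k * n)) := by ring
        _ ≤ _ := by linarith
    linarith
end

section
/- For every real ε > 0 and every real α ∈ (1/2, 1] there exist a constant δ > 0 and N ∈ ℕ such that for all n ≥ N and every integer m with α·n ≤ m ≤ n: if C and B are independent uniformly random matrices in F₂^{m×n}, then the F₂-rank of Cᵀ·B + Bᵀ·C satisfies Pr[rank(Cᵀ·B + Bᵀ·C) ≤ (1−ε)·n] ≤ 2^{−δ·n²}. -/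
open scoped BigOperators Classical

abbrev F2 := ZMod 2

lemma card_mat (a b : Type) [Fintype a] [Fintype b] [DecidableEq a] [DecidableEq b] [Fintype (Matrix a b F2)] :
    Fintype.card (Matrix a b F2) = 2 ^ (Fintype.card a * Fintype.card b) := by
  have : Fintype.card (Matrix a b F2) = Fintype.card (a → b → F2) :=
    Fintype.card_congr (Equiv.refl _)
  rw [this, Fintype.card_fun, Fintype.card_fun, ZMod.card, ← pow_mul, mul_comm]

lemma sylvester_rank {l m n : Type} [Fintype l] [Fintype m] [Fintype n]
    (A : Matrix l m F2) (B : Matrix m n F2) :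
    A.rank + B.rank ≤ (A * B).rank + Fintype.card m := by
  classical
  have h1 := LinearMap.finrank_range_add_finrank_ker (A.mulVecLin.domRestrict (LinearMap.range B.mulVecLin))
  have h2 := LinearMap.finrank_range_add_finrank_ker A.mulVecLin
  have h3 : LinearMap.range (A.mulVecLin.domRestrict (LinearMap.range B.mulVecLin)) =
      LinearMap.range (A * B).mulVecLin := by
    rw [Matrix.mulVecLin_mul, LinearMap.range_comp, LinearMap.range_domRestrict]
  have h4 : Module.finrank F2 (LinearMap.ker (A.mulVecLin.domRestrict (LinearMap.range B.mulVecLin)))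
      ≤ Module.finrank F2 (LinearMap.ker A.mulVecLin) := by
    rw [LinearMap.ker_domRestrict]
    refine LinearMap.finrank_le_finrank_of_injective
      (f := ((LinearMap.range B.mulVecLin).subtype.restrict
        (p := (LinearMap.ker A.mulVecLin).submoduleOf (LinearMap.range B.mulVecLin))
        (q := LinearMap.ker A.mulVecLin) (fun x hx => hx))) ?_
    intro x y h
    apply Subtype.ext
    apply Subtype.ext
    exact congrArg (fun z => z.1) h
  rw [h3] at h1
  simp only [Module.finrank_fintype_fun_eq_card] at h2
  unfold Matrix.rank
  omega

lemma card_mul_zero {m n k : Type} [Fintype m] [Fintype n] [Fintype k]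
    (M : Matrix m n F2) :
    (Finset.univ.filter fun X : Matrix n k F2 => M * X = 0).card
      = 2 ^ ((Fintype.card n - M.rank) * Fintype.card k) := by
  classical
  have h2 := LinearMap.finrank_range_add_finrank_ker M.mulVecLin
  simp only [Module.finrank_fintype_fun_eq_card] at h2
  have e : {X : Matrix n k F2 // M * X = 0} ≃ (k → LinearMap.ker M.mulVecLin) :=
    { toFun := fun X j => ⟨fun i => X.1 i j, by
        rw [LinearMap.mem_ker]
        ext i
        exact congrFun (congrFun X.2 i) j⟩
      invFun := fun f => ⟨Matrix.of fun i j => (f j).1 i, by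
        ext i j
        exact congrFun ((f j).2) i⟩
      left_inv := fun X => rfl
      right_inv := fun f => rfl }
  rw [← Fintype.card_subtype, Fintype.card_congr e, Fintype.card_fun,
    Module.card_eq_pow_finrank (K := F2), ZMod.card, ← pow_mul]
  congr 2
  unfold Matrix.rank
  omega

/-- the nontrivial sign character -/
lemma sum_char {V : Type} [AddCommGroup V] [Fintype V] (χ : AddChar F2 ℂ) (hχ : χ ≠ 0)
    (φ : V →+ F2) : ∑ v, χ (φ v) = if (∀ v, φ v = 0) then (Fintype.card V : ℂ) else 0 := by
  classical
  have h := AddChar.sum_eq_ite (χ.compAddMonoidHom φ)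
  simp only [AddChar.compAddMonoidHom_apply] at h
  rw [h]
  congr 1
  have h1 : χ 1 ≠ 1 := by
    intro h1
    apply hχ
    ext x
    have hx : x = 0 ∨ x = 1 := by revert x; decide
    rcases hx with rfl | rfl
    · rw [AddChar.map_zero_eq_one, AddChar.map_zero_eq_one]
    · rw [h1]; rfl
  simp only [eq_iff_iff]
  constructor
  · intro h v
    have := DFunLike.congr_fun h v
    simp only [AddChar.compAddMonoidHom_apply, AddChar.zero_apply] at this
    by_contra hv
    have : φ v = 1 := by
      have hx : ∀ x : F2, x ≠ 0 → x = 1 := by decide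
      exact hx _ hv
    simp_all
  · intro h
    ext v
    simp [h]

lemma dual_count {V W : Type} [AddCommGroup V] [Fintype V] [AddCommGroup W] [Fintype W]
    (β : V →+ W →+ F2) :
    (Finset.univ.filter fun v => ∀ w, β v w = 0).card * Fintype.card W
      = (Finset.univ.filter fun w => ∀ v, β v w = 0).card * Fintype.card V := by
  classical
  obtain ⟨χ, hχ⟩ : ∃ χ : AddChar F2 ℂ, χ ≠ 0 :=
    ⟨ZMod.stdAddChar, fun h => by
      have := ZMod.isPrimitive_stdAddChar 2
      exact this one_ne_zero (by rw [h]; ext; simp)⟩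
  have h1 : ∑ v, ∑ w, χ (β v w) =
      ((Finset.univ.filter fun v => ∀ w, β v w = 0).card * Fintype.card W : ℂ) := by
    simp_rw [fun v => sum_char χ hχ (β v)]
    rw [← Finset.sum_filter]
    simp
  have h2 : ∑ v, ∑ w, χ (β v w) =
      ((Finset.univ.filter fun w => ∀ v, β v w = 0).card * Fintype.card V : ℂ) := by
    rw [Finset.sum_comm]
    have := fun w => sum_char χ hχ (β.flip w)
    simp only [AddMonoidHom.flip_apply] at this
    rw [Finset.sum_congr rfl (fun w _ => this w), Finset.card_filter]
    push_cast
    rw [Finset.sum_mul]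
    refine Finset.sum_congr rfl fun w _ => ?_
    by_cases h : ∀ v, β v w = 0 <;> simp [h]
  exact_mod_cast h1.symm.trans h2

lemma count_B {m n k : ℕ} (C : Matrix (Fin m) (Fin n) F2) (X : Matrix (Fin n) (Fin k) F2) :
    (Finset.univ.filter fun B : Matrix (Fin m) (Fin n) F2 =>
      (C.transpose * B + B.transpose * C) * X = 0).card * 2 ^ (n * k)
    = (Finset.univ.filter fun Y : Matrix (Fin n) (Fin k) F2 =>
      C * (X * Y.transpose + Y * X.transpose) = 0).card * 2 ^ (m * n) := by
  let β : Matrix (Fin m) (Fin n) F2 →+ Matrix (Fin n) (Fin k) F2 →+ F2 :=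
    AddMonoidHom.mk' (fun B => AddMonoidHom.mk'
      (fun Y => ((C.transpose * B + B.transpose * C) * X * Y.transpose).trace)
      (fun Y Z => by simp [Matrix.mul_add]))
      (fun B D => by
        ext Y
        simp [Matrix.mul_add, Matrix.add_mul]
        ring)
  have hβ : ∀ B Y, β B Y = ((C.transpose * B + B.transpose * C) * X * Y.transpose).trace :=
    fun B Y => rfl
  have hβ2 : ∀ B Y, β B Y = (C * (X * Y.transpose + Y * X.transpose) * B.transpose).trace := by
    intro B Y
    rw [hβ, Matrix.mul_add, Matrix.add_mul, Matrix.add_mul, Matrix.add_mul, Matrix.trace_add,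
      Matrix.trace_add, add_comm]
    congr 1
    · rw [Matrix.mul_assoc, Matrix.mul_assoc, Matrix.trace_mul_comm, Matrix.mul_assoc]
    · rw [← Matrix.trace_transpose]
      simp only [Matrix.transpose_mul, Matrix.transpose_transpose]
      simp only [← Matrix.mul_assoc]
      rw [Matrix.trace_mul_comm]
      simp only [← Matrix.mul_assoc]
  have key := dual_count β
  have c1 : ∀ B, (∀ Y, β B Y = 0) ↔ (C.transpose * B + B.transpose * C) * X = 0 := by
    intro B
    rw [Matrix.ext_iff_trace_mul_right]
    constructor
    · intro h Z
      have := h Z.transpose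
      rw [hβ, Matrix.transpose_transpose] at this
      simpa using this
    · intro h Y
      rw [hβ, h]; simp
  have c2 : ∀ Y, (∀ B, β B Y = 0) ↔ C * (X * Y.transpose + Y * X.transpose) = 0 := by
    intro B
    rw [Matrix.ext_iff_trace_mul_right]
    constructor
    · intro h Z
      have := h Z.transpose
      rw [hβ2, Matrix.transpose_transpose] at this
      simpa using this
    · intro h Y
      rw [hβ2, h]; simp
  simp only [c1, c2] at key
  have e1 : Fintype.card (Matrix (Fin n) (Fin k) F2) = 2 ^ (n * k) := by
    rw [card_mat]; simp
  have e2 : Fintype.card (Matrix (Fin m) (Fin n) F2) = 2 ^ (m * n) := by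
    rw [card_mat]; simp
  rw [e1, e2] at key
  exact key

lemma count_C {m n : ℕ} (N : Matrix (Fin n) (Fin n) F2) :
    (Finset.univ.filter fun C : Matrix (Fin m) (Fin n) F2 => C * N = 0).card
      = 2 ^ ((n - N.rank) * m) := by
  have := card_mul_zero (k := Fin m) N.transpose
  rw [Matrix.rank_transpose] at this
  simp only [Fintype.card_fin] at this
  rw [← this]
  refine Finset.card_bij (fun C _ => C.transpose) ?_ ?_ ?_
  · intro C hC
    simp only [Finset.mem_filter, Finset.mem_univ, true_and] at hC ⊢
    rw [← Matrix.transpose_mul, hC, Matrix.transpose_zero]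
  · intro C _ D _ h
    exact Matrix.transpose_injective h
  · intro D hD
    simp only [Finset.mem_filter, Finset.mem_univ, true_and] at hD ⊢
    refine ⟨D.transpose, ?_, Matrix.transpose_transpose _⟩
    rw [← Matrix.transpose_transpose N, ← Matrix.transpose_mul, hD, Matrix.transpose_zero]

lemma rank_N {n k : ℕ} (X Y : Matrix (Fin n) (Fin k) F2) :
    2 * (Matrix.fromCols X Y).rank ≤ (X * Y.transpose + Y * X.transpose).rank + 2 * k := by
  have h := sylvester_rank (Matrix.fromCols X Y) (Matrix.fromRows Y.transpose X.transpose)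
  rw [Matrix.fromCols_mul_fromRows] at h
  have h2 : (Matrix.fromRows Y.transpose X.transpose).rank = (Matrix.fromCols X Y).rank := by
    rw [← Matrix.transpose_fromCols, Matrix.rank_transpose]
    have : Matrix.fromCols Y X = (Matrix.fromCols X Y).submatrix (Equiv.refl _) (Equiv.sumComm _ _) := by
      ext i j
      rcases j with j | j <;> rfl
    rw [this, Matrix.rank_submatrix]
  rw [h2] at h
  simp only [Fintype.card_sum, Fintype.card_fin] at h
  omega

lemma card_submodule (d : Type) [Fintype d] :
    Nat.card (Submodule F2 (d → F2)) ≤ 2 ^ (Fintype.card d * Fintype.card d) := by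
  classical
  have hs : Function.Surjective
      (fun M : Matrix d d F2 => (LinearMap.range M.mulVecLin : Submodule F2 (d → F2))) := by
    intro R
    obtain ⟨g, hg⟩ := LinearMap.exists_leftInverse_of_injective R.subtype (by simp)
    refine ⟨LinearMap.toMatrix' (R.subtype ∘ₗ g), ?_⟩
    have hg' : LinearMap.range g = ⊤ := by
      rw [LinearMap.range_eq_top]
      intro x
      exact ⟨x, LinearMap.congr_fun hg x⟩
    change LinearMap.range (Matrix.toLin' _) = R
    rw [Matrix.toLin'_toMatrix', LinearMap.range_comp, hg']
    simp
  refine (Nat.card_le_card_of_surjective _ hs).trans ?_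
  rw [Nat.card_eq_fintype_card, card_mat]

lemma sum_W (n : ℕ) (d : Type) [Fintype d] [DecidableEq d] :
    ∑ W : Matrix (Fin n) d F2, (1 : ℝ) / 2 ^ (n * W.rank) ≤ 2 ^ (Fintype.card d * Fintype.card d) := by
  classical
  have : Fintype (Submodule F2 (d → F2)) := Fintype.ofFinite _
  rw [← Finset.sum_fiberwise (s := Finset.univ) (g := fun W : Matrix (Fin n) d F2 => Submodule.span F2 (Set.range W.row))]
  calc _ ≤ ∑ R : Submodule F2 (d → F2), (1 : ℝ) := by
        apply Finset.sum_le_sum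
        intro R _
        calc _ = ∑ W : Matrix (Fin n) d F2 with Submodule.span F2 (Set.range W.row) = R,
              (1 : ℝ) / 2 ^ (n * Module.finrank F2 R) := by
              apply Finset.sum_congr rfl
              intro W hW
              simp only [Finset.mem_filter, Finset.mem_univ, true_and] at hW
              rw [Matrix.rank_eq_finrank_span_row, hW]
          _ ≤ 1 := by
              rw [Finset.sum_const, nsmul_eq_mul, mul_one_div, div_le_one (by positivity)]
              have hc : Fintype.card (Fin n → R) = 2 ^ (n * Module.finrank F2 R) := by
                rw [Fintype.card_fun, Module.card_eq_pow_finrank (K := F2), ZMod.card, ← pow_mul, Fintype.card_fin, mul_comm]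
              have : (Finset.univ.filter fun W : Matrix (Fin n) d F2 =>
                  Submodule.span F2 (Set.range W.row) = R).card ≤ Fintype.card (Fin n → R) := by
                rw [← Fintype.card_subtype]
                refine Fintype.card_le_of_injective (fun W i => ⟨W.1 i, ?_⟩) ?_
                · exact W.2.le (Submodule.subset_span ⟨i, rfl⟩)
                · intro W Z h
                  apply Subtype.ext
                  ext i j
                  exact congrFun (congrArg Subtype.val (congrFun h i)) j
              rw [hc] at this
              exact_mod_cast this
    _ ≤ _ := by
        have := card_submodule d
        rw [Nat.card_eq_fintype_card] at this
        simp only [Finset.sum_const, nsmul_eq_mul, mul_one, Finset.card_univ]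
        exact_mod_cast this

lemma sum_cols (n k : ℕ) (f : Matrix (Fin n) (Fin k ⊕ Fin k) F2 → ℝ) :
    ∑ X : Matrix (Fin n) (Fin k) F2, ∑ Y : Matrix (Fin n) (Fin k) F2, f (Matrix.fromCols X Y)
      = ∑ W, f W := by
  rw [← Fintype.sum_prod_type' (fun X Y => f (Matrix.fromCols X Y))]
  refine Fintype.sum_bijective (fun p => Matrix.fromCols p.1 p.2) ⟨?_, ?_⟩ _ _ (fun _ => rfl)
  · rintro ⟨a, b⟩ ⟨c, d⟩ h
    obtain ⟨h1, h2⟩ := Matrix.fromCols_inj h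
    exact Prod.ext h1 h2
  · intro W
    exact ⟨(W.toCols₁, W.toCols₂), Matrix.fromCols_toCols W⟩

set_option maxHeartbeats 1000000 in
lemma moment (m n k : ℕ) (hm : n ≤ 2 * m) :
    ∑ CB : Matrix (Fin m) (Fin n) F2 × Matrix (Fin m) (Fin n) F2,
      (2 : ℝ) ^ ((n - (CB.1.transpose * CB.2 + CB.2.transpose * CB.1).rank) * k)
    ≤ 2 ^ (m * n) * 2 ^ (m * n) * 2 ^ (4 * k * k) := by
  have s1 : ∑ CB : Matrix (Fin m) (Fin n) F2 × Matrix (Fin m) (Fin n) F2,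
      2 ^ ((n - (CB.1.transpose * CB.2 + CB.2.transpose * CB.1).rank) * k) * 2 ^ (n * k)
      = ∑ X : Matrix (Fin n) (Fin k) F2, ∑ Y : Matrix (Fin n) (Fin k) F2,
        2 ^ ((n - (X * Y.transpose + Y * X.transpose).rank) * m) * 2 ^ (m * n) := by
    have a1 : ∀ CB : Matrix (Fin m) (Fin n) F2 × Matrix (Fin m) (Fin n) F2,
        2 ^ ((n - (CB.1.transpose * CB.2 + CB.2.transpose * CB.1).rank) * k)
        = ∑ X : Matrix (Fin n) (Fin k) F2,
          if (CB.1.transpose * CB.2 + CB.2.transpose * CB.1) * X = 0 then 1 else 0 := by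
      intro CB
      have := card_mul_zero (k := Fin k) (CB.1.transpose * CB.2 + CB.2.transpose * CB.1)
      simp only [Fintype.card_fin] at this
      refine this.symm.trans ?_
      rw [Finset.card_filter]
      congr!
    have a2 : ∀ X Y : Matrix (Fin n) (Fin k) F2,
        2 ^ ((n - (X * Y.transpose + Y * X.transpose).rank) * m)
        = ∑ C : Matrix (Fin m) (Fin n) F2,
          if C * (X * Y.transpose + Y * X.transpose) = 0 then 1 else 0 := by
      intro X Y
      rw [← count_C, Finset.card_filter]
    simp_rw [a1, a2, ← Finset.sum_mul]
    rw [Fintype.sum_prod_type, Finset.sum_mul, Finset.sum_mul]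
    have b1 : ∀ C : Matrix (Fin m) (Fin n) F2, ∀ X : Matrix (Fin n) (Fin k) F2,
        (∑ B : Matrix (Fin m) (Fin n) F2,
          if (C.transpose * B + B.transpose * C) * X = 0 then 1 else 0) * 2 ^ (n * k)
        = (∑ Y : Matrix (Fin n) (Fin k) F2,
          if C * (X * Y.transpose + Y * X.transpose) = 0 then 1 else 0) * 2 ^ (m * n) := by
      intro C X
      rw [← Finset.card_filter, ← Finset.card_filter, count_B]
    calc _ = ∑ C : Matrix (Fin m) (Fin n) F2, ∑ X : Matrix (Fin n) (Fin k) F2,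
          (∑ B : Matrix (Fin m) (Fin n) F2,
          if (C.transpose * B + B.transpose * C) * X = 0 then 1 else 0) * 2 ^ (n * k) := by
          apply Finset.sum_congr rfl
          intro C _
          rw [← Finset.sum_mul, Finset.sum_comm]
      _ = ∑ C : Matrix (Fin m) (Fin n) F2, ∑ X : Matrix (Fin n) (Fin k) F2,
        (∑ Y : Matrix (Fin n) (Fin k) F2,
          if C * (X * Y.transpose + Y * X.transpose) = 0 then 1 else 0) * 2 ^ (m * n) := by
          simp_rw [b1]
      _ = _ := by
          rw [Finset.sum_comm]
          apply Finset.sum_congr rfl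
          intro X _
          rw [← Finset.sum_mul, Finset.sum_comm]
  have s2 : ∀ X Y : Matrix (Fin n) (Fin k) F2,
      (2 : ℝ) ^ ((n - (X * Y.transpose + Y * X.transpose).rank) * m)
      ≤ 2 ^ (m * n) * 2 ^ (n * k) * (1 / 2 ^ (n * (Matrix.fromCols X Y).rank)) := by
    intro X Y
    rw [mul_one_div, le_div_iff₀ (by positivity), ← pow_add, ← pow_add]
    apply pow_le_pow_right₀ (by norm_num)
    have h1 := rank_N X Y
    have h2 : (X * Y.transpose + Y * X.transpose).rank ≤ n := Matrix.rank_le_width _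
    generalize (X * Y.transpose + Y * X.transpose).rank = r at *
    generalize (Matrix.fromCols X Y).rank = ρ at *
    zify [h2]
    zify at h1 h2 hm
    nlinarith [mul_nonneg (sub_nonneg.2 hm) (Int.natCast_nonneg r), mul_nonneg (sub_nonneg.2 h1) (Int.natCast_nonneg n)]
  have s3 : ∑ X : Matrix (Fin n) (Fin k) F2, ∑ Y : Matrix (Fin n) (Fin k) F2,
      (1 : ℝ) / 2 ^ (n * (Matrix.fromCols X Y).rank) ≤ 2 ^ (4 * k * k) := by
    have := sum_W n (Fin k ⊕ Fin k)
    simp only [Fintype.card_sum, Fintype.card_fin] at this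
    rw [show 4 * k * k = (k + k) * (k + k) by ring]
    refine le_trans (le_of_eq ?_) this
    exact sum_cols n k (fun W => (1 : ℝ) / 2 ^ (n * W.rank))
  have s1' := congrArg (Nat.cast (R := ℝ)) s1
  push_cast at s1'
  rw [← Finset.sum_mul] at s1'
  refine le_of_mul_le_mul_right ?_ (show (0 : ℝ) < 2 ^ (n * k) by positivity)
  rw [s1']
  calc _ ≤ ∑ X : Matrix (Fin n) (Fin k) F2, ∑ Y : Matrix (Fin n) (Fin k) F2,
      (2 ^ (m * n) * 2 ^ (n * k) * (1 / 2 ^ (n * (Matrix.fromCols X Y).rank))) * (2 : ℝ) ^ (m * n) := by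
        gcongr with X _ Y _
        exact s2 X Y
    _ = (2 ^ (m * n) * 2 ^ (n * k) * 2 ^ (m * n)) * ∑ X : Matrix (Fin n) (Fin k) F2, ∑ Y : Matrix (Fin n) (Fin k) F2,
      (1 : ℝ) / 2 ^ (n * (Matrix.fromCols X Y).rank) := by
        simp_rw [Finset.mul_sum]
        refine Finset.sum_congr rfl fun X _ => Finset.sum_congr rfl fun Y _ => ?_
        ring
    _ ≤ (2 ^ (m * n) * 2 ^ (n * k) * 2 ^ (m * n)) * 2 ^ (4 * k * k) := by gcongr
    _ = _ := by ring

theorem stmt10 (ε α : ℝ) (hε : 0 < ε) (hα1 : 1 / 2 < α) (hα2 : α ≤ 1) :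
    ∃ δ : ℝ, 0 < δ ∧ ∃ N : ℕ, ∀ n : ℕ, N ≤ n → ∀ m : ℕ,
      α * n ≤ (m : ℝ) → m ≤ n →
      (((Finset.univ.filter fun CB :
            Matrix (Fin m) (Fin n) (ZMod 2) × Matrix (Fin m) (Fin n) (ZMod 2) =>
            ((CB.1.transpose * CB.2 + CB.2.transpose * CB.1).rank : ℝ)
              ≤ (1 - ε) * n).card : ℝ)
          / ((Finset.univ : Finset
              (Matrix (Fin m) (Fin n) (ZMod 2) × Matrix (Fin m) (Fin n) (ZMod 2))).card : ℝ))
        ≤ (2 : ℝ) ^ (-(δ * (n : ℝ) ^ 2)) := by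
  refine ⟨ε ^ 2 / 32, by positivity, ⌈8 / ε⌉₊, ?_⟩
  intro n hn m hm hmn
  have hn' : 8 ≤ ε * n := by
    have : 8 / ε ≤ n := Nat.ceil_le.1 hn
    rw [div_le_iff₀ hε] at this
    linarith
  have hm2 : n ≤ 2 * m := by
    have : (n : ℝ) ≤ 2 * m := by
      have : (0 : ℝ) ≤ n := Nat.cast_nonneg n
      nlinarith
    exact_mod_cast this
  set k := ⌊ε * n / 8⌋₊ with hk
  have hk1 : (k : ℝ) ≤ ε * n / 8 := Nat.floor_le (by linarith)
  have hk2 : ε * n / 16 ≤ k := by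
    have h1 : ε * n / 8 < k + 1 := Nat.lt_floor_add_one _
    have h2 : 1 ≤ k := Nat.le_floor (by push_cast; linarith)
    have h3 : (1 : ℝ) ≤ k := by exact_mod_cast h2
    linarith
  have hmom := moment m n k hm2
  set S := (Finset.univ.filter fun CB :
            Matrix (Fin m) (Fin n) (ZMod 2) × Matrix (Fin m) (Fin n) (ZMod 2) =>
            ((CB.1.transpose * CB.2 + CB.2.transpose * CB.1).rank : ℝ)
              ≤ (1 - ε) * n) with hS
  have hlow : (S.card : ℝ) * (2 : ℝ) ^ (ε * n * k) ≤
      2 ^ (m * n) * 2 ^ (m * n) * 2 ^ (4 * k * k) := by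
    refine le_trans ?_ hmom
    rw [← nsmul_eq_mul, ← Finset.sum_const]
    refine le_trans (Finset.sum_le_sum (fun CB hCB => ?_))
      (Finset.sum_le_sum_of_subset_of_nonneg (Finset.subset_univ S) (fun _ _ _ => by positivity))
    have h1 := (Finset.mem_filter.1 hCB).2
    have h2 : (CB.1.transpose * CB.2 + CB.2.transpose * CB.1).rank ≤ n := Matrix.rank_le_width _
    rw [← Real.rpow_natCast]
    apply Real.rpow_le_rpow_of_exponent_le (by norm_num)
    push_cast [h2]
    have : (0 : ℝ) ≤ k := Nat.cast_nonneg k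
    gcongr
    linarith
  have hcard : ((Finset.univ : Finset
      (Matrix (Fin m) (Fin n) (ZMod 2) × Matrix (Fin m) (Fin n) (ZMod 2))).card : ℝ)
      = 2 ^ (m * n) * 2 ^ (m * n) := by
    rw [Finset.card_univ, Fintype.card_prod, card_mat]
    simp
  rw [hcard, div_le_iff₀ (by positivity)]
  refine le_of_mul_le_mul_right (hlow.trans ?_) (show (0 : ℝ) < 2 ^ (ε * n * k) by positivity)
  have e : (2 : ℝ) ^ (4 * k * k) ≤ 2 ^ (-(ε ^ 2 / 32 * (n : ℝ) ^ 2)) * 2 ^ (ε * n * k) := by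
    rw [← Real.rpow_natCast, ← Real.rpow_add (by norm_num)]
    apply Real.rpow_le_rpow_of_exponent_le (by norm_num)
    push_cast
    have : (0 : ℝ) ≤ k := Nat.cast_nonneg k
    nlinarith [mul_nonneg this (sub_nonneg.2 hk1), mul_nonneg (sub_nonneg.2 hk2) (show 0 ≤ ε * n by linarith)]
  calc _ ≤ (2 : ℝ) ^ (m * n) * 2 ^ (m * n) * (2 ^ (-(ε ^ 2 / 32 * (n : ℝ) ^ 2)) * 2 ^ (ε * n * k)) := by
        gcongr
    _ = _ := by ring
end
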